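/- Let q ≥ 3 be an integer and let ℒ_q(s) = ∏_χ L(s,χ) be the product of the Dirichlet L-functions L(s,χ) over all Dirichlet characters χ modulo q. Then ℒ_q has at most one zero s = σ + it in the region σ ≥ 1 − 1/(6.3970 · log(q · max(1,|t|))); that is, there is at most one complex number s with ℒ_q(s) = 0 and Re s ≥ 1 − 1/(6.3970 · log(q · max(1, |Im s|))). Moreover, if such a zero exists, it is real. -/

import Mathlib

set_option autoImplicit false

open scoped Real

open Complex

namespace KadiriZeroFree

open Filter Set Asymptotics

lemma isBigO_of_exp_growth {f : ℂ → ℂ} {l r C K : ℝ} (hlr : l < r)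
    (hg : ∀ z : ℂ, l < z.re → z.re < r → 1 ≤ |z.im| → ‖f z‖ ≤ C * Real.exp (K * |z.im|)) :
    ∃ c < π / (r - l), ∃ B, f =O[comap (_root_.abs ∘ im) atTop ⊓ 𝓟 (re ⁻¹' Ioo l r)]
      fun z ↦ Real.exp (B * Real.exp (c * |z.im|)) := by
  have hw : 0 < r - l := sub_pos.2 hlr
  have hc : 0 < π / (r - l) / 2 := by positivity
  refine ⟨π / (r - l) / 2, by linarith, |K| / (π / (r - l) / 2), ?_⟩
  refine IsBigO.of_bound |C| ?_
  have h1 : ∀ᶠ z : ℂ in comap (_root_.abs ∘ im) atTop, 1 ≤ |z.im| :=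
    tendsto_comap.eventually (eventually_ge_atTop (1 : ℝ))
  filter_upwards [h1.filter_mono inf_le_left, mem_inf_of_right (mem_principal_self _)] with z hz hz'
  refine (hg z hz'.1 hz'.2 hz).trans ?_
  rw [Real.norm_of_nonneg (Real.exp_pos _).le]
  refine mul_le_mul (le_abs_self C) (Real.exp_le_exp.2 ?_) (Real.exp_pos _).le (abs_nonneg _)
  set c := π / (r - l) / 2
  have h2 : c * |z.im| ≤ Real.exp (c * |z.im|) := by linarith [Real.add_one_le_exp (c * |z.im|)]
  calc K * |z.im| ≤ |K| * |z.im| := by gcongr; exact le_abs_self K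
    _ = |K| / c * (c * |z.im|) := by field_simp
    _ ≤ _ := by gcongr

/-- A convexity bound in a strip: the boundary values of modulus at most `1` on the right and
`(m (A + t²)) ^ (θ (r - l))` on the left are interpolated through an explicit harmonic majorant. -/
lemma norm_le_of_strip {f : ℂ → ℂ} {l r θ m A C K : ℝ} (hlr : l < r) (hθ : 0 ≤ θ) (hm : 0 < m)
    (hA : 0 < A) (hf : DiffContOnCl ℂ f (re ⁻¹' Ioo l r))
    (hg : ∀ z : ℂ, l < z.re → z.re < r → 1 ≤ |z.im| → ‖f z‖ ≤ C * Real.exp (K * |z.im|))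
    (hl : ∀ z : ℂ, z.re = l →
      ‖f z‖ ≤ Real.exp (θ * (r - l) * Real.log (m * (A + z.im ^ 2))))
    (hr : ∀ z : ℂ, z.re = r → ‖f z‖ ≤ 1) {w : ℂ} (hwl : l ≤ w.re) (hwr : w.re ≤ r) :
    ‖f w‖ ≤ Real.exp (θ * (r - w.re) *
      Real.log (m * (A + w.im ^ 2 + ((r - l) ^ 2 - (r - w.re) ^ 2) / 3))) := by
  set W := r - l with hW
  have hW0 : 0 < W := sub_pos.2 hlr
  set P := A + w.im ^ 2 + (W ^ 2 - (r - w.re) ^ 2) / 3 with hP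
  have hP0 : 0 < P := by
    have : (r - w.re) ^ 2 ≤ W ^ 2 := by
      apply pow_le_pow_left₀ <;> linarith
    have := sq_nonneg w.im
    have : 0 ≤ (W ^ 2 - (r - w.re) ^ 2) / 3 := by linarith
    positivity
  set E : ℂ → ℂ := fun z ↦ θ * ((Real.log (m * P) - 1 : ℝ) * (r - z) +
    (1 / P : ℝ) * ((A : ℝ) * (r - z) + ((W : ℂ) ^ 2 * (r - z) - (r - z) ^ 3) / 3)) with hE
  have hEre : ∀ z : ℂ, (E z).re = θ * ((Real.log (m * P) - 1) * (r - z.re) +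
      (1 / P) * ((r - z.re) * (A + z.im ^ 2) + (W ^ 2 * (r - z.re) - (r - z.re) ^ 3) / 3)) := by
    intro z
    have e : ∀ u : ℂ, (u ^ 3).re = u.re ^ 3 - 3 * u.re * u.im ^ 2 := by
      intro u; simp [pow_succ]; ring
    have e3 : ((((W : ℂ) ^ 2 * (r - z) - (r - z) ^ 3) / 3 : ℂ)).re =
        (W ^ 2 * (r - z.re) - ((r - z.re) ^ 3 - 3 * (r - z.re) * z.im ^ 2)) / 3 := by
      rw [show (3 : ℂ) = ((3 : ℝ) : ℂ) by norm_num, Complex.div_ofReal_re, Complex.sub_re, e,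
        ← Complex.ofReal_pow, Complex.re_ofReal_mul]
      simp
    simp only [hE, Complex.re_ofReal_mul, Complex.add_re, e3, Complex.sub_re, Complex.ofReal_re]
    ring
  have hEd : Differentiable ℂ E := by
    simp only [hE]; fun_prop
  have key : ‖f w * cexp (-E w)‖ ≤ 1 := by
    have hbd : ∀ z : ℂ, l < z.re → z.re < r → -(E z).re ≤ θ * |Real.log (m * P) - 1| * W := by
      intro z h1 h2
      rw [hEre]
      have hx : 0 ≤ r - z.re := by linarith
      have hxW : r - z.re ≤ W := by linarith
      have h3 : 0 ≤ (1 / P) * ((r - z.re) * (A + z.im ^ 2) +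
          (W ^ 2 * (r - z.re) - (r - z.re) ^ 3) / 3) := by
        have : (r - z.re) ^ 3 ≤ W ^ 2 * (r - z.re) := by
          have : (r - z.re) ^ 2 ≤ W ^ 2 := pow_le_pow_left₀ hx hxW 2
          nlinarith
        have : 0 ≤ (W ^ 2 * (r - z.re) - (r - z.re) ^ 3) / 3 := by linarith
        positivity
      have h4 : -((Real.log (m * P) - 1) * (r - z.re)) ≤ |Real.log (m * P) - 1| * W := by
        calc _ ≤ |Real.log (m * P) - 1| * (r - z.re) := by
              rw [← neg_mul]; gcongr; exact neg_le_abs _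
          _ ≤ _ := by gcongr
      nlinarith
    have hdc : DiffContOnCl ℂ (fun z ↦ f z * cexp (-E z)) (re ⁻¹' Ioo l r) := by
      simpa [mul_comm] using (hEd.neg.cexp.diffContOnCl).smul hf
    refine PhragmenLindelof.vertical_strip (f := fun z ↦ f z * cexp (-E z)) hdc
      (isBigO_of_exp_growth (C := |C| * Real.exp (θ * |Real.log (m * P) - 1| * W)) (K := K) hlr
        fun z h1 h2 h3 ↦ ?_) (fun z hz ↦ ?_) (fun z hz ↦ ?_) hwl hwr
    · rw [norm_mul, Complex.norm_exp, Complex.neg_re]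
      calc ‖f z‖ * Real.exp (-(E z).re)
          ≤ (|C| * Real.exp (K * |z.im|)) * Real.exp (θ * |Real.log (m * P) - 1| * W) := by
            gcongr
            · exact (hg z h1 h2 h3).trans (by gcongr; exact le_abs_self C)
            · exact hbd z h1 h2
        _ = _ := by ring
    · rw [norm_mul, Complex.norm_exp, Complex.neg_re, hEre, hz]
      have hAt : 0 < A + z.im ^ 2 := by positivity
      have h5 : Real.log (m * (A + z.im ^ 2)) ≤
          Real.log (m * P) - 1 + (1 / P) * (A + z.im ^ 2) := by
        have h6 := Real.log_le_sub_one_of_pos (div_pos hAt hP0)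
        rw [Real.log_div hAt.ne' hP0.ne'] at h6
        rw [Real.log_mul hm.ne' hAt.ne', Real.log_mul hm.ne' hP0.ne']
        have : (1 / P) * (A + z.im ^ 2) = (A + z.im ^ 2) / P := by ring
        linarith
      refine (mul_le_mul_of_nonneg_right (hl z hz) (Real.exp_pos _).le).trans ?_
      rw [← Real.exp_add, Real.exp_le_one_iff, ← hW]
      have := mul_le_mul_of_nonneg_left h5 (mul_nonneg hθ hW0.le)
      nlinarith
    · rw [norm_mul, Complex.norm_exp, Complex.neg_re, hEre, hz]
      simpa using hr z hz
  rw [norm_mul, Complex.norm_exp, Complex.neg_re, hEre] at key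
  have h7 : θ * ((Real.log (m * P) - 1) * (r - w.re) +
      (1 / P) * ((r - w.re) * (A + w.im ^ 2) + (W ^ 2 * (r - w.re) - (r - w.re) ^ 3) / 3)) =
      θ * (r - w.re) * Real.log (m * P) := by
    have : (r - w.re) * (A + w.im ^ 2) + (W ^ 2 * (r - w.re) - (r - w.re) ^ 3) / 3 =
      (r - w.re) * P := by rw [hP]; ring
    rw [this]
    field_simp
    ring
  rw [h7, Real.exp_neg, ← div_eq_mul_inv, div_le_one (Real.exp_pos _)] at key
  exact key

end KadiriZeroFree

namespace KadiriZeroFree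

open Filter Set MeasureTheory

lemma exists_norm_mellin_le {f : ℝ → ℂ} {a b : ℝ} (ha : MellinConvergent f a)
    (hb : MellinConvergent f b) :
    ∃ C, ∀ s : ℂ, a ≤ s.re → s.re ≤ b → ‖mellin f s‖ ≤ C := by
  refine ⟨∫ t in Ioi (0 : ℝ), (‖((t : ℂ) ^ ((a : ℂ) - 1)) • f t‖ +
    ‖((t : ℂ) ^ ((b : ℂ) - 1)) • f t‖), fun s h1 h2 ↦ ?_⟩
  refine norm_integral_le_of_norm_le (ha.norm.add hb.norm) ?_
  refine (ae_restrict_iff' measurableSet_Ioi).2 (ae_of_all _ fun t ht ↦ ?_)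
  have ht : 0 < t := ht
  simp only [norm_smul, Complex.norm_cpow_eq_rpow_re_of_pos ht, ← add_mul]
  gcongr
  simp only [Complex.sub_re, Complex.ofReal_re, Complex.one_re]
  rcases le_total t 1 with h | h
  · have := Real.rpow_le_rpow_of_exponent_ge ht h (sub_le_sub_right h1 1)
    have := Real.rpow_nonneg ht.le (b - 1)
    linarith
  · have := Real.rpow_le_rpow_of_exponent_le h (sub_le_sub_right h2 1)
    have := Real.rpow_nonneg ht.le (a - 1)
    linarith

lemma exists_norm_Gamma_le {a b : ℝ} (ha : 0 < a) :
    ∃ C, ∀ s : ℂ, a ≤ s.re → s.re ≤ b → ‖Gamma s‖ ≤ C := by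
  rcases lt_or_ge b a with hab | hab
  · exact ⟨0, fun s h1 h2 ↦ absurd (h1.trans h2) (not_le.2 hab)⟩
  have hc : ∀ c : ℝ, 0 < c → MellinConvergent (fun t : ℝ ↦ ((Real.exp (-t) : ℝ) : ℂ)) c := by
    intro c hc
    have := Complex.GammaIntegral_convergent (s := (c : ℂ)) (by simpa)
    refine this.congr_fun (fun t _ ↦ ?_) measurableSet_Ioi
    simp [mul_comm]
  obtain ⟨C, hC⟩ := exists_norm_mellin_le (hc a ha) (hc b (by linarith))
  refine ⟨C, fun s h1 h2 ↦ ?_⟩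
  rw [Complex.Gamma_eq_integral (by linarith), Complex.GammaIntegral_eq_mellin]
  exact hC s h1 h2

lemma norm_sin_le_exp (z : ℂ) : ‖Complex.sin z‖ ≤ Real.exp |z.im| := by
  rw [Complex.sin, norm_div, norm_mul, Complex.norm_I, mul_one, Complex.norm_ofNat]
  have h1 : ‖cexp (-z * I)‖ ≤ Real.exp |z.im| := by
    rw [Complex.norm_exp]; gcongr; simpa using le_abs_self z.im
  have h2 : ‖cexp (z * I)‖ ≤ Real.exp |z.im| := by
    rw [Complex.norm_exp]; gcongr; simpa using neg_le_abs z.im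
  have := norm_sub_le (cexp (-z * I)) (cexp (z * I))
  linarith

lemma exists_norm_inv_Gamma_le (a : ℝ) (n : ℕ) :
    ∃ C, 0 ≤ C ∧ ∀ s : ℂ, a ≤ s.re → s.re ≤ 1 / 2 + n → 1 / 2 ≤ |s.im| →
      ‖(Gamma s)⁻¹‖ ≤ C * Real.exp (π * |s.im|) := by
  induction n generalizing a with
  | zero =>
    obtain ⟨C, hC⟩ := exists_norm_Gamma_le (a := 1 / 2) (b := 1 - a) (by norm_num)
    refine ⟨|C| / π, by positivity, fun s h1 h2 h3 ↦ ?_⟩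
    have hs : Complex.sin (π * s) ≠ 0 := by
      intro h
      rw [Complex.sin_eq_zero_iff] at h
      obtain ⟨k, hk⟩ := h
      have hk2 : (π * s : ℂ).im = (k * π : ℂ).im := by rw [hk]
      have : π * s.im = 0 := by simpa using hk2
      rcases mul_eq_zero.1 this with h | h
      · exact Real.pi_ne_zero h
      · rw [h] at h3; norm_num at h3
    have hG := Complex.Gamma_mul_Gamma_one_sub s
    have hpi : (π : ℂ) ≠ 0 := by exact_mod_cast Real.pi_ne_zero
    have hG0 : Gamma s ≠ 0 := by
      intro h; rw [h, zero_mul] at hG; exact div_ne_zero hpi hs hG.symm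
    have e : (Gamma s)⁻¹ = Gamma (1 - s) * Complex.sin (π * s) / π := by
      rw [eq_div_iff hs] at hG
      rw [eq_div_iff hpi, inv_mul_eq_iff_eq_mul₀ hG0]
      linear_combination -hG
    rw [e, norm_div, norm_mul, Complex.norm_real, Real.norm_of_nonneg Real.pi_pos.le,
      div_mul_eq_mul_div]
    gcongr
    · refine (hC _ ?_ ?_).trans (le_abs_self C)
      · simp only [Complex.sub_re, Complex.one_re]; norm_num at h2; linarith
      · simp only [Complex.sub_re, Complex.one_re]; linarith
    · refine (norm_sin_le_exp _).trans ?_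
      simp [abs_mul, abs_of_pos Real.pi_pos]
  | succ n ih =>
    obtain ⟨C, hC0, hC⟩ := ih (a - 1)
    refine ⟨2 * C, by positivity, fun s h1 h2 h3 ↦ ?_⟩
    have hs1 : s - 1 ≠ 0 := by
      intro h
      have : (s - 1).im = 0 := by rw [h]; simp
      simp only [Complex.sub_im, Complex.one_im, sub_zero] at this
      rw [this] at h3; norm_num at h3
    have e := Complex.Gamma_add_one (s - 1) hs1
    rw [sub_add_cancel] at e
    rw [e, mul_inv, norm_mul]
    have h4 : ‖(s - 1)⁻¹‖ ≤ 2 := by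
      rw [norm_inv]
      refine inv_le_of_inv_le₀ (by norm_num) (le_trans (by norm_num) (h3.trans ?_))
      simpa using Complex.abs_im_le_norm (s - 1)
    have h5 := hC (s - 1) (by simpa using h1) (by
      simp only [Complex.sub_re, Complex.one_re]; push_cast at h2; linarith) (by simpa using h3)
    simp only [Complex.sub_im, Complex.one_im, sub_zero] at h5
    calc _ ≤ 2 * ‖(Gamma (s - 1))⁻¹‖ := by gcongr
      _ ≤ _ := by rw [mul_assoc]; gcongr

lemma norm_Gamma_ratio_le {a : ℝ} (ha : a = 0 ∨ a = 1) {s : ℂ} (h1 : -(3 / 2) ≤ s.re)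
    (h2 : s.re ≤ 0) :
    ‖Gamma ((1 + a - s) / 2) / Gamma ((a + s) / 2)‖ ≤
      Real.exp ((1 / 2 - s.re) / 2 * Real.log ((1 / 4) * (5 / 2 + s.im ^ 2))) := by
  have ha0 : 0 ≤ a := by rcases ha with rfl | rfl <;> norm_num
  have ha1 : a ≤ 1 := by rcases ha with rfl | rfl <;> norm_num
  have hre : ∀ z : ℂ, ((1 + a - z) / 2).re = (1 + a - z.re) / 2 := by
    intro z; rw [show (2 : ℂ) = ((2 : ℝ) : ℂ) by norm_num, Complex.div_ofReal_re]; simp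
  have him : ∀ z : ℂ, ((1 + a - z) / 2).im = - z.im / 2 := by
    intro z; rw [show (2 : ℂ) = ((2 : ℝ) : ℂ) by norm_num, Complex.div_ofReal_im]; simp
  have hre' : ∀ z : ℂ, ((a + z) / 2).re = (a + z.re) / 2 := by
    intro z; rw [show (2 : ℂ) = ((2 : ℝ) : ℂ) by norm_num, Complex.div_ofReal_re]; simp
  have him' : ∀ z : ℂ, ((a + z) / 2).im = z.im / 2 := by
    intro z; rw [show (2 : ℂ) = ((2 : ℝ) : ℂ) by norm_num, Complex.div_ofReal_im]; simp
  obtain ⟨C₁, hC₁⟩ := exists_norm_Gamma_le (a := 1 / 4) (b := 2) (by norm_num)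
  obtain ⟨C₂, hC₂0, hC₂⟩ := exists_norm_inv_Gamma_le (-2) 1
  have hd : ∀ z : ℂ, z.re ≤ 1 / 2 →
      DifferentiableAt ℂ (fun z : ℂ ↦ Gamma ((1 + a - z) / 2) * (Gamma ((a + z) / 2))⁻¹) z := by
    intro z hz
    refine DifferentiableAt.mul ?_ ?_
    · refine DifferentiableAt.comp z (Complex.differentiableAt_Gamma _ fun m hm ↦ ?_) (by fun_prop)
      have := congrArg Complex.re hm
      rw [hre] at this
      simp only [Complex.neg_re, Complex.natCast_re] at this
      have : (0 : ℝ) ≤ m := m.cast_nonneg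
      linarith
    · exact (Complex.differentiable_one_div_Gamma _).comp z (f := fun z : ℂ ↦ (a + z) / 2)
        (by fun_prop)
  have hd' : DiffContOnCl ℂ (fun z : ℂ ↦ Gamma ((1 + a - z) / 2) * (Gamma ((a + z) / 2))⁻¹)
      (re ⁻¹' Ioo (-(3 / 2)) (1 / 2)) := by
    refine DifferentiableOn.diffContOnCl fun z hz ↦ (hd z ?_).differentiableWithinAt
    rw [Complex.closure_preimage_re, closure_Ioo (by norm_num)] at hz
    exact hz.2
  have hconj : ∀ z w : ℂ, w = (starRingEnd ℂ) z → ‖Gamma w‖ = ‖Gamma z‖ := by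
    intro z w h
    rw [h, Complex.Gamma_conj, Complex.norm_conj]
  have key := norm_le_of_strip (l := -(3 / 2)) (r := 1 / 2) (θ := 1 / 2) (m := 1 / 4) (A := 5 / 4)
    (C := |C₁| * C₂) (K := π) (by norm_num) (by norm_num) (by norm_num) (by norm_num) hd'
    (fun z g1 g2 g3 ↦ ?_) (fun z hz ↦ ?_) (fun z hz ↦ ?_) (w := s) h1 (by linarith)
  · rw [← div_eq_mul_inv] at key
    refine key.trans (Real.exp_le_exp.2 ?_)
    rw [show 1 / 2 * (1 / 2 - s.re) = (1 / 2 - s.re) / 2 by ring]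
    refine mul_le_mul_of_nonneg_left (Real.log_le_log ?_ ?_) (by linarith)
    · have := sq_nonneg s.im
      nlinarith
    · nlinarith
  · rw [norm_mul, mul_assoc]
    refine mul_le_mul ((hC₁ _ ?_ ?_).trans (le_abs_self _)) ?_ (norm_nonneg _) (abs_nonneg _)
    · rw [hre]; linarith
    · rw [hre]; linarith
    · refine (hC₂ _ ?_ ?_ ?_).trans ?_
      · rw [hre']; linarith
      · rw [hre']; push_cast; linarith
      · rw [him', abs_div, abs_two]; linarith
      · have : |z.im / 2| ≤ |z.im| := by
          rw [abs_div, abs_two]; linarith [abs_nonneg z.im]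
        rw [him']
        gcongr
  · set u : ℂ := (a + z) / 2 with hu
    have hur : u.re = a / 2 - 3 / 4 := by rw [hre', hz]; ring
    have hui : u.im = z.im / 2 := him' z
    have hu0 : u ≠ 0 := by
      intro h
      rw [h, Complex.zero_re] at hur
      rcases ha with rfl | rfl <;> norm_num at hur
    have hu1 : u + 1 ≠ 0 := by
      intro h
      have := congrArg Complex.re h
      rw [Complex.add_re, hur, Complex.one_re, Complex.zero_re] at this
      rcases ha with rfl | rfl <;> norm_num at this
    rw [norm_mul, norm_inv, hconj (u + 2), show u + 2 = u + 1 + 1 by ring,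
      Complex.Gamma_add_one _ hu1, Complex.Gamma_add_one _ hu0, norm_mul, norm_mul]
    · have h5 : ‖u + 1‖ * ‖u‖ ≤ 1 / 4 * (5 / 4 + z.im ^ 2) := by
        refine abs_le_of_sq_le_sq' ?_ (by positivity) |>.2
        rw [mul_pow, ← Complex.normSq_eq_norm_sq, ← Complex.normSq_eq_norm_sq,
          Complex.normSq_apply, Complex.normSq_apply, Complex.add_re, Complex.add_im, hur, hui]
        rcases ha with rfl | rfl <;> simp <;> nlinarith
      rw [show (1 : ℝ) / 2 * (1 / 2 - -(3 / 2)) = 1 by norm_num, one_mul, Real.exp_log (by positivity)]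
      refine le_trans ?_ h5
      rw [← mul_assoc, mul_assoc]
      exact mul_le_of_le_one_right (by positivity) (mul_inv_le_one)
    · apply Complex.ext
      · rw [hre, Complex.conj_re, Complex.add_re, hur, hz, Complex.re_ofNat]; ring
      · rw [him, Complex.conj_im, Complex.add_im, hui, Complex.im_ofNat]; ring
  · rw [norm_mul, norm_inv, ← div_eq_mul_inv, hconj ((a + z) / 2)]
    · exact div_self_le_one _
    · apply Complex.ext
      · rw [hre, Complex.conj_re, hre', hz]; ring
      · rw [him, Complex.conj_im, him']; ring

end KadiriZeroFree

namespace KadiriZeroFree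

open Filter Set MeasureTheory Asymptotics HurwitzZeta DirichletCharacter

lemma isBigO_one_mellin_strip {P : WeakFEPair ℂ} (hP : IsStrongFEPair P) (l r : ℝ) :
    P.Λ =O[𝓟 {s : ℂ | l ≤ s.re ∧ s.re ≤ r}] fun _ ↦ (1 : ℝ) := by
  obtain ⟨C, hC⟩ := exists_norm_mellin_le (hP.hasMellin (l : ℂ)).1 (hP.hasMellin (r : ℂ)).1
  refine isBigO_principal.2 ⟨C, fun s hs ↦ ?_⟩
  rw [hP.Λ_eq]
  simpa using hC s hs.1 hs.2

lemma isBigO_one_completedLFunction {N : ℕ} [NeZero N] (χ : DirichletCharacter ℂ N) (l r : ℝ) :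
    completedLFunction χ =O[𝓟 {s : ℂ | l ≤ s.re ∧ s.re ≤ r ∧ 1 ≤ |s.im|}] fun _ ↦ (1 : ℝ) := by
  set S := {s : ℂ | l ≤ s.re ∧ s.re ≤ r ∧ 1 ≤ |s.im|} with hS
  have hN : (1 : ℝ) ≤ N := by exact_mod_cast NeZero.one_le
  have hmul : ∀ {f g : ℂ → ℂ}, f =O[𝓟 S] (fun _ ↦ (1 : ℝ)) → g =O[𝓟 S] (fun _ ↦ (1 : ℝ)) →
      (fun s ↦ f s * g s) =O[𝓟 S] fun _ ↦ (1 : ℝ) := fun hf hg ↦ by simpa using hf.mul hg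
  have hc : ∀ c : ℂ, (fun _ : ℂ ↦ c) =O[𝓟 S] fun _ ↦ (1 : ℝ) := fun c ↦
    isBigO_const_const c one_ne_zero _
  have hn : (fun s : ℂ ↦ (N : ℂ) ^ (-s)) =O[𝓟 S] fun _ ↦ (1 : ℝ) := by
    refine isBigO_principal.2 ⟨(N : ℝ) ^ (-l), fun s hs ↦ ?_⟩
    rw [Complex.norm_natCast_cpow_of_pos (NeZero.pos N)]
    simpa using Real.rpow_le_rpow_of_exponent_le hN (neg_le_neg hs.1)
  have hinv : ∀ f : ℂ → ℂ, (∀ s, |(f s).im| = |s.im|) →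
      (fun s : ℂ ↦ (f s)⁻¹) =O[𝓟 S] fun _ ↦ (1 : ℝ) := by
    intro f hf
    refine isBigO_principal.2 ⟨1, fun s hs ↦ ?_⟩
    rw [norm_inv, norm_one, mul_one]
    refine inv_le_one_of_one_le₀ (hs.2.2.trans ?_)
    rw [← hf s]
    exact Complex.abs_im_le_norm _
  have hE : ∀ a, (completedHurwitzZetaEven₀ a) =O[𝓟 S] fun _ ↦ (1 : ℝ) := by
    intro a
    have h := isBigO_one_mellin_strip (hurwitzEvenFEPair a).isStrongFEPair_toStrongFEPair
      (l / 2) (r / 2)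
    rw [(hurwitzEvenFEPair a).isStrongFEPair_toStrongFEPair.Λ_eq] at h
    have h2 := h.comp_tendsto (k := fun s : ℂ ↦ s / 2) (l' := 𝓟 S) (by
      rw [tendsto_principal_principal]
      intro s hs
      simp only [mem_ofPred_eq, Complex.div_ofNat_re]
      constructor <;> linarith [hs.1, hs.2.1])
    exact (h2.mul (hc (1 / 2))).congr (fun s ↦ by
      simp only [completedHurwitzZetaEven₀, WeakFEPair.Λ₀, Function.comp, WeakFEPair.toStrongFEPair]
      ring) (fun s ↦ by simp)
  have hO : ∀ a, (completedHurwitzZetaOdd a) =O[𝓟 S] fun _ ↦ (1 : ℝ) := by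
    intro a
    have h := isBigO_one_mellin_strip (isStrong_hurwitzOddFEPair a) ((l + 1) / 2) ((r + 1) / 2)
    have h2 := h.comp_tendsto (k := fun s : ℂ ↦ (s + 1) / 2) (l' := 𝓟 S) (by
      rw [tendsto_principal_principal]
      intro s hs
      simp only [mem_ofPred_eq, Complex.div_ofNat_re, Complex.add_re, Complex.one_re]
      constructor <;> linarith [hs.1, hs.2.1])
    exact (h2.mul (hc (1 / 2))).congr (fun s ↦ by
      simp only [completedHurwitzZetaOdd, Function.comp]
      ring) (fun s ↦ by simp)
  have h0 : ZMod.completedLFunction₀ χ =O[𝓟 S] fun _ ↦ (1 : ℝ) := by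
    refine (hmul hn ?_).add (hmul hn ?_)
    · exact IsBigO.fun_sum fun j _ ↦ hmul (hc _) (hE _)
    · exact IsBigO.fun_sum fun j _ ↦ hmul (hc _) (hO _)
  refine ((h0.sub (hmul (hmul hn (hc (χ 0))) (hinv (fun s ↦ s) fun s ↦ rfl))).sub
    (hmul (hmul hn (hc (∑ j, χ j))) (hinv (fun s ↦ 1 - s) fun s ↦ ?_))).congr_left fun s ↦ ?_
  · simp
  · rw [completedLFunction, ZMod.completedLFunction_eq, div_eq_mul_inv, div_eq_mul_inv]

lemma norm_inv_Gammaℝ (s : ℂ) : ‖(Gammaℝ s)⁻¹‖ = π ^ (s.re / 2) * ‖(Gamma (s / 2))⁻¹‖ := by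
  rw [Gammaℝ_def, mul_inv, norm_mul, ← Complex.cpow_neg,
    Complex.norm_cpow_eq_rpow_re_of_pos Real.pi_pos]
  congr 2
  simp [neg_div]

lemma exists_norm_inv_gammaFactor_le {N : ℕ} (χ : DirichletCharacter ℂ N) (l r : ℝ) :
    ∃ C, ∀ s : ℂ, l ≤ s.re → s.re ≤ r → 1 ≤ |s.im| →
      ‖(gammaFactor χ s)⁻¹‖ ≤ C * Real.exp (π * |s.im|) := by
  obtain ⟨n, hn⟩ := exists_nat_ge ((r + 1) / 2)
  obtain ⟨C, hC0, hC⟩ := exists_norm_inv_Gamma_le (l / 2) n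
  have key : ∀ s : ℂ, l ≤ s.re → s.re ≤ r + 1 → 1 ≤ |s.im| →
      ‖(Gammaℝ s)⁻¹‖ ≤ π ^ ((r + 1) / 2) * C * Real.exp (π * |s.im|) := by
    intro s h1 h2 h3
    rw [norm_inv_Gammaℝ, mul_assoc]
    have h4 : |(s / 2).im| = |s.im| / 2 := by rw [Complex.div_ofNat_im, abs_div]; simp
    refine mul_le_mul (Real.rpow_le_rpow_of_exponent_le (by linarith [Real.pi_gt_three])
      (by linarith)) ((hC _ ?_ ?_ ?_).trans ?_) (norm_nonneg _) (by positivity)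
    · rw [Complex.div_ofNat_re]; linarith
    · rw [Complex.div_ofNat_re]; linarith
    · rw [h4]; linarith
    · rw [h4]; gcongr; linarith
  rcases χ.even_or_odd with h | h
  · refine ⟨π ^ ((r + 1) / 2) * C, fun s h1 h2 h3 ↦ ?_⟩
    rw [h.gammaFactor_def]
    exact key s h1 (by linarith) h3
  · refine ⟨π ^ ((r + 1) / 2) * C, fun s h1 h2 h3 ↦ ?_⟩
    rw [h.gammaFactor_def]
    have := key (s + 1) (by simp; linarith) (by simpa using h2) (by simpa using h3)
    simpa using this

lemma exists_norm_LFunction_le {N : ℕ} [NeZero N] (χ : DirichletCharacter ℂ N) (l r : ℝ) :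
    ∃ C, ∀ s : ℂ, l ≤ s.re → s.re ≤ r → 1 ≤ |s.im| →
      ‖LFunction χ s‖ ≤ C * Real.exp (π * |s.im|) := by
  obtain ⟨A, hA⟩ := isBigO_principal.1 (isBigO_one_completedLFunction χ l r)
  obtain ⟨C, hC⟩ := exists_norm_inv_gammaFactor_le χ l r
  refine ⟨|A| * C, fun s h1 h2 h3 ↦ ?_⟩
  have hs : s ≠ 0 := by rintro rfl; norm_num at h3
  rw [LFunction_eq_completed_div_gammaFactor χ s (Or.inl hs), div_eq_mul_inv, norm_mul, mul_assoc]
  have := hA s ⟨h1, h2, h3⟩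
  rw [norm_one, mul_one] at this
  exact mul_le_mul (this.trans (le_abs_self A)) (hC s h1 h2 h3) (norm_nonneg _) (abs_nonneg _)

lemma conj_LSeries (f : ℕ → ℂ) (s : ℂ) :
    (starRingEnd ℂ) (LSeries f s) = LSeries (fun n ↦ (starRingEnd ℂ) (f n)) ((starRingEnd ℂ) s) := by
  rw [LSeries, LSeries, Complex.conj_tsum]
  refine tsum_congr fun n ↦ ?_
  rcases eq_or_ne n 0 with rfl | hn
  · simp
  · rw [LSeries.term_of_ne_zero hn, LSeries.term_of_ne_zero hn, map_div₀,
      Complex.cpow_conj _ _ (by simp [Complex.natCast_arg, Real.pi_ne_zero.symm]), Complex.conj_natCast]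

lemma conj_apply_dirichletCharacter {N : ℕ} [NeZero N] (χ : DirichletCharacter ℂ N) (a : ZMod N) :
    (starRingEnd ℂ) (χ a) = χ⁻¹ a := by
  rw [← MulChar.star_eq_inv]
  simp [MulChar.star_apply]

lemma conj_LFunction_of_one_lt {N : ℕ} [NeZero N] (χ : DirichletCharacter ℂ N) {s : ℂ}
    (hs : 1 < s.re) :
    (starRingEnd ℂ) (LFunction χ s) = LFunction χ⁻¹ ((starRingEnd ℂ) s) := by
  rw [LFunction_eq_LSeries _ hs, LFunction_eq_LSeries _ (by simpa using hs), conj_LSeries]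
  simp_rw [conj_apply_dirichletCharacter]

lemma conj_LFunction {N : ℕ} [NeZero N] (χ : DirichletCharacter ℂ N) {s : ℂ} (hs : s ≠ 1) :
    (starRingEnd ℂ) (LFunction χ s) = LFunction χ⁻¹ ((starRingEnd ℂ) s) := by
  have hU : IsOpen ({1}ᶜ : Set ℂ) := isOpen_compl_singleton
  have h1 : AnalyticOnNhd ℂ (LFunction χ⁻¹) {1}ᶜ :=
    DifferentiableOn.analyticOnNhd (fun z hz ↦
      (differentiableAt_LFunction _ z (Or.inl hz)).differentiableWithinAt) hU
  have h2 : AnalyticOnNhd ℂ (starRingEnd ℂ ∘ LFunction χ ∘ starRingEnd ℂ) {1}ᶜ := by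
    refine DifferentiableOn.analyticOnNhd (fun z hz ↦ ?_) hU
    refine (differentiableAt_conj_conj_iff.2
      (differentiableAt_LFunction χ _ (Or.inl ?_))).differentiableWithinAt
    intro h
    apply hz
    rw [mem_singleton_iff, ← Complex.conj_conj z, h, map_one]
  have h3 : EqOn (starRingEnd ℂ ∘ LFunction χ ∘ starRingEnd ℂ) (LFunction χ⁻¹) {1}ᶜ := by
    refine h2.eqOn_of_preconnected_of_eventuallyEq h1
      (isConnected_compl_singleton_of_one_lt_rank (by simp) _).isPreconnected
      (z₀ := 2) (by norm_num) ?_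
    have : {z : ℂ | 1 < z.re} ∈ nhds (2 : ℂ) :=
      (isOpen_lt continuous_const continuous_re).mem_nhds (by simp)
    filter_upwards [this] with z hz
    have := conj_LFunction_of_one_lt χ (s := (starRingEnd ℂ) z) (by simpa using hz)
    simpa using this
  have h4 := h3 (x := (starRingEnd ℂ) s) (by
    intro h
    apply hs
    rw [← Complex.conj_conj s, h, map_one])
  simpa using h4

lemma norm_gaussSum {N : ℕ} [NeZero N] {χ : DirichletCharacter ℂ N} (hχ : χ.IsPrimitive) :
    ‖gaussSum χ ZMod.stdAddChar‖ ^ 2 = N := by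
  have h1 : gaussSum χ ZMod.stdAddChar * gaussSum χ⁻¹ ZMod.stdAddChar = N * χ (-1) := by
    have h := congrFun (ZMod.dft_dft (χ : ZMod N → ℂ)) 1
    have h2 : ZMod.dft (χ : ZMod N → ℂ) =
        fun k ↦ gaussSum χ ZMod.stdAddChar * (χ⁻¹ : DirichletCharacter ℂ N) (-k) := by
      funext k
      rw [hχ.fourierTransform_eq_inv_mul_gaussSum]
      ring
    have h3 : (χ⁻¹ : DirichletCharacter ℂ N).IsPrimitive := by
      rw [isPrimitive_def, conductor_inv]; exact hχ
    rw [h2, ZMod.dft_const_mul, ZMod.dft_comp_neg] at h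
    simp only [h3.fourierTransform_eq_inv_mul_gaussSum] at h
    simpa using h
  have h2 : star (gaussSum χ ZMod.stdAddChar) = χ (-1) * gaussSum χ⁻¹ ZMod.stdAddChar := by
    have h5 := gaussSum_mulShift χ⁻¹ (ZMod.stdAddChar (N := N)) (-1)
    rw [star_gaussSum_eq, AddChar.inv_mulShift, ← h5, ← conj_apply_dirichletCharacter, ← mul_assoc,
      Units.val_neg, Units.val_one, Complex.mul_conj]
    rcases χ.even_or_odd with h | h
    · rw [h]; simp
    · rw [h]; simp
  have h3 : χ (-1) * χ (-1) = 1 := by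
    rw [← map_mul]; simp
  have h4 : ((‖gaussSum χ ZMod.stdAddChar‖ ^ 2 : ℝ) : ℂ) = N := by
    rw [Complex.ofReal_pow, ← Complex.mul_conj', starRingEnd_apply, h2]
    linear_combination χ (-1) * h1 + (N : ℂ) * h3
  exact_mod_cast h4

lemma norm_rootNumber {N : ℕ} [NeZero N] {χ : DirichletCharacter ℂ N} (hχ : χ.IsPrimitive) :
    ‖rootNumber χ‖ = 1 := by
  have hN : (0 : ℝ) < N := by exact_mod_cast NeZero.pos N
  rw [rootNumber, norm_div, norm_div, norm_pow, Complex.norm_I, one_pow, div_one,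
    Complex.norm_natCast_cpow_of_pos (NeZero.pos N), div_eq_one_iff_eq (by positivity)]
  rw [← Real.sqrt_sq (norm_nonneg (gaussSum _ _)), norm_gaussSum hχ, Real.sqrt_eq_rpow]
  norm_num

lemma exists_norm_gammaFactor_div {N : ℕ} (χ : DirichletCharacter ℂ N) :
    ∃ a : ℝ, (a = 0 ∨ a = 1) ∧ ∀ s : ℂ,
      ‖gammaFactor χ⁻¹ (1 - s) / gammaFactor χ s‖ =
        π ^ (s.re - 1 / 2) * ‖Gamma ((1 + a - s) / 2) / Gamma ((a + s) / 2)‖ := by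
  have key : ∀ u v : ℂ, ‖Gammaℝ u / Gammaℝ v‖ =
      π ^ ((v.re - u.re) / 2) * ‖Gamma (u / 2) / Gamma (v / 2)‖ := by
    intro u v
    rw [Gammaℝ_def, Gammaℝ_def, mul_div_mul_comm, norm_mul, norm_div,
      Complex.norm_cpow_eq_rpow_re_of_pos Real.pi_pos,
      Complex.norm_cpow_eq_rpow_re_of_pos Real.pi_pos, ← Real.rpow_sub Real.pi_pos]
    congr 2
    simp only [Complex.div_ofNat_re, Complex.neg_re]
    ring
  rcases χ.even_or_odd with h | h
  · refine ⟨0, Or.inl rfl, fun s ↦ ?_⟩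
    have h' : (χ⁻¹ : DirichletCharacter ℂ N).Even := by
      rw [DirichletCharacter.Even, MulChar.inv_apply_eq_inv, h]; simp
    rw [h.gammaFactor_def, h'.gammaFactor_def, key]
    simp only [Complex.sub_re, Complex.one_re, Complex.ofReal_zero, add_zero, zero_add]
    congr 2
    ring
  · refine ⟨1, Or.inr rfl, fun s ↦ ?_⟩
    have h' : (χ⁻¹ : DirichletCharacter ℂ N).Odd := by
      rw [DirichletCharacter.Odd, MulChar.inv_apply_eq_inv', h]
      norm_num
    rw [h.gammaFactor_def, h'.gammaFactor_def, key]
    simp only [Complex.sub_re, Complex.one_re, Complex.add_re, Complex.ofReal_one]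
    congr 2
    · ring
    · congr 3
      · ring
      · ring

/-- The functional equation bounds `L(s, χ)` to the left of the critical strip by its values to
the right of it. -/
lemma norm_LFunction_le_of_re_eq {N : ℕ} [NeZero N] {χ : DirichletCharacter ℂ N}
    (hχ : χ.IsPrimitive) {δ : ℝ} (hδ : 0 < δ) (hδ' : δ ≤ 3 / 2) {z : ℂ} (hz : z.re = -δ) :
    ‖LFunction χ z‖ ≤
      Real.exp ((1 + 2 * δ) / 4 * Real.log ((N / (2 * π)) ^ 2 * (5 / 2 + z.im ^ 2))) *
        ‖LFunction χ (1 - (starRingEnd ℂ) z)‖ := by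
  have hN : (0 : ℝ) < N := by exact_mod_cast NeZero.pos N
  have hre : 1 < (1 - z).re := by simp [hz, hδ]
  obtain ⟨a, ha, hG⟩ := exists_norm_gammaFactor_div χ
  have hz0 : z ≠ 0 := by rintro rfl; simp at hz; linarith
  have hs0 : 1 - z ≠ 0 := by
    intro h; rw [h] at hre; norm_num at hre
  have hγ : gammaFactor χ⁻¹ (1 - z) ≠ 0 := by
    rcases (χ⁻¹ : DirichletCharacter ℂ N).even_or_odd with h | h
    · rw [h.gammaFactor_def]; exact Gammaℝ_ne_zero_of_re_pos (by linarith)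
    · rw [h.gammaFactor_def]; exact Gammaℝ_ne_zero_of_re_pos (by simp at hre ⊢; linarith)
  have h1 := LFunction_eq_completed_div_gammaFactor χ z (Or.inl hz0)
  have h2 := LFunction_eq_completed_div_gammaFactor χ⁻¹ (1 - z) (Or.inl hs0)
  have h3 := hχ.completedLFunction_one_sub (1 - z)
  rw [sub_sub_cancel] at h3
  rw [eq_div_iff hγ] at h2
  have h4 : LFunction χ z = (N : ℂ) ^ (1 - z - 1 / 2) * rootNumber χ * LFunction χ⁻¹ (1 - z) *
      (gammaFactor χ⁻¹ (1 - z) / gammaFactor χ z) := by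
    rw [h1, h3, ← h2]; ring
  have h5 : ‖LFunction χ⁻¹ (1 - z)‖ = ‖LFunction χ (1 - (starRingEnd ℂ) z)‖ := by
    rw [← Complex.norm_conj, conj_LFunction_of_one_lt _ hre, inv_inv]
    simp
  rw [h4, norm_mul, norm_mul, norm_mul, norm_rootNumber hχ, h5, mul_one, hG, hz,
    Complex.norm_natCast_cpow_of_pos (NeZero.pos N), mul_comm _ ‖LFunction _ _‖, mul_assoc,
    mul_comm _ ‖LFunction _ _‖]
  gcongr
  have h6 := norm_Gamma_ratio_le ha (s := z) (by linarith) (by linarith)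
  have h7 : (1 - z - 1 / 2 : ℂ).re = 1 / 2 + δ := by
    rw [show (1 - z - 1 / 2 : ℂ) = ((1 / 2 : ℝ) : ℂ) - z by push_cast; ring]
    rw [Complex.sub_re, Complex.ofReal_re, hz]; ring
  rw [h7]
  calc _ ≤ (N : ℝ) ^ (1 / 2 + δ) * (π ^ (-δ - 1 / 2) * Real.exp ((1 / 2 - z.re) / 2 *
        Real.log ((1 / 4) * (5 / 2 + z.im ^ 2)))) := by gcongr
    _ = _ := by
      rw [Real.rpow_def_of_pos hN, Real.rpow_def_of_pos Real.pi_pos, ← Real.exp_add, ← Real.exp_add,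
        hz, Real.log_mul (by positivity) (by positivity), Real.log_mul (by positivity) (by positivity),
        Real.log_pow, Real.log_div hN.ne' (by positivity),
        Real.log_mul (x := 2) (by positivity) (by positivity),
        show (1 / 4 : ℝ) = (2 ^ 2)⁻¹ by norm_num, Real.log_inv, Real.log_pow]
      congr 1
      push_cast
      ring

end KadiriZeroFree

namespace KadiriZeroFree

open Filter Set Topology

/-- A holomorphic function near the strip `-δ ≤ re s ≤ 1 + δ` of finite exponential type there,
bounded by `1` on the right edge and by `(m (A + t²)) ^ ((1 + 2 δ) / 4)` on the left edge. -/
structure IsStripBounded (δ m A : ℝ) (G : ℂ → ℂ) : Prop where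
  differentiableOn : DifferentiableOn ℂ G {s | -(2 * δ) < s.re ∧ s.re < 1 + 2 * δ}
  growth : ∃ C K : ℝ, 0 ≤ C ∧ 0 ≤ K ∧ ∀ z : ℂ, -δ ≤ z.re → z.re ≤ 1 + δ → 1 ≤ |z.im| →
    ‖G z‖ ≤ C * Real.exp (K * |z.im|)
  left : ∀ z : ℂ, z.re = -δ →
    ‖G z‖ ≤ Real.exp ((1 + 2 * δ) / 4 * Real.log (m * (A + z.im ^ 2)))
  right : ∀ z : ℂ, z.re = 1 + δ → ‖G z‖ ≤ 1

lemma isOpen_strip (a b : ℝ) : IsOpen {s : ℂ | a < s.re ∧ s.re < b} :=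
  (isOpen_lt continuous_const continuous_re).inter (isOpen_lt continuous_re continuous_const)

lemma nonneg_deriv_of_right_nonneg {u : ℝ → ℝ} {u' κ : ℝ} (hκ : 0 < κ) (hu : HasDerivAt u u' 0)
    (h0 : u 0 = 0) (hpos : ∀ h, 0 ≤ h → h ≤ κ → 0 ≤ u h) : 0 ≤ u' := by
  have h1 := (hasDerivAt_iff_tendsto_slope.1 hu).mono_left
    (nhdsWithin_mono (0 : ℝ) (s := Ioi 0) fun x hx ↦ ne_of_gt hx)
  refine ge_of_tendsto h1 ?_
  filter_upwards [Ioo_mem_nhdsGT hκ] with x hx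
  rw [slope_def_field, h0, sub_zero, sub_zero]
  exact div_nonneg (hpos x hx.1.le hx.2.le) hx.1.le

lemma IsStripBounded.neg_re_logDeriv_le {δ m A : ℝ} (hδ : 0 < δ) (hm : 0 < m) (hA : 0 < A)
    {G : ℂ → ℂ} (hG : IsStripBounded δ m A G) {s : ℂ} (hs : s.re = 1 + δ) (hGs : ‖G s‖ = 1) :
    -(logDeriv G s).re ≤ 1 / 4 * Real.log (m * (A + s.im ^ 2 + (1 + 2 * δ) ^ 2 / 3)) := by
  have hU := isOpen_strip (-(2 * δ)) (1 + 2 * δ)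
  have hG0 : G s ≠ 0 := by
    intro h; rw [h, norm_zero] at hGs; norm_num at hGs
  obtain ⟨C, K, hC, hK, hgr⟩ := hG.growth
  have hcont : DiffContOnCl ℂ G (re ⁻¹' Ioo (-δ) (1 + δ)) := by
    refine DifferentiableOn.diffContOnCl (hG.differentiableOn.mono fun z hz ↦ ?_)
    rw [Complex.closure_preimage_re, closure_Ioo (by linarith)] at hz
    exact ⟨by linarith [hz.1], by linarith [hz.2]⟩
  have hd : HasDerivAt G (deriv G s) s :=
    ((hG.differentiableOn s ⟨by linarith, by linarith⟩).differentiableAt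
      (hU.mem_nhds ⟨by linarith, by linarith⟩)).hasDerivAt
  set ℓ := Real.log (m * (A + s.im ^ 2 + (1 + 2 * δ) ^ 2 / 3)) with hℓ
  have hin : HasDerivAt (fun h : ℝ ↦ s - (h : ℂ)) (-1) 0 := by
    simpa using (Complex.ofRealCLM.hasDerivAt (x := (0 : ℝ))).const_sub s
  have hcomp : HasDerivAt (fun h : ℝ ↦ G (s - (h : ℂ)) / G s) (-(deriv G s) / G s) 0 := by
    have hd' : HasDerivAt G (deriv G s) (s - ((0 : ℝ) : ℂ)) := by simpa using hd
    have := (hd'.comp (0 : ℝ) hin).div_const (G s)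
    simpa using this
  have hre := (Complex.reCLM.hasFDerivAt.comp_hasDerivAt (0 : ℝ) hcomp)
  have hexp : HasDerivAt (fun h : ℝ ↦ Real.exp (1 / 4 * h * ℓ)) (1 / 4 * ℓ) 0 := by
    have := (((hasDerivAt_id (0 : ℝ)).const_mul (1 / 4 : ℝ)).mul_const ℓ).exp
    simpa using this
  have key := nonneg_deriv_of_right_nonneg (κ := 1 + 2 * δ) (by linarith) (hexp.sub hre)
    (by simp [hG0]) (fun h h0 h1 ↦ ?_)
  · have e : (Complex.reCLM (-(deriv G s) / G s)) = -(logDeriv G s).re := by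
      rw [logDeriv_apply, neg_div]; simp
    rw [e] at key
    linarith
  · have hb := norm_le_of_strip (l := -δ) (r := 1 + δ) (θ := 1 / 4) (m := m) (A := A) (C := C)
      (K := K) (by linarith) (by norm_num) hm hA hcont
      (fun z g1 g2 g3 ↦ hgr z g1.le g2.le g3) (fun z hz ↦ ?_) hG.right
      (w := s - (h : ℂ)) (by simp [hs]; linarith) (by simp [hs]; linarith)
    · simp only [Function.comp, Pi.sub_apply, sub_nonneg]
      calc _ ≤ ‖G (s - (h : ℂ)) / G s‖ := Complex.re_le_norm _
        _ = ‖G (s - (h : ℂ))‖ := by rw [norm_div, hGs, div_one]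
        _ ≤ _ := hb
        _ ≤ _ := by
          apply Real.exp_le_exp.2
          have e1 : (1 + δ - (s - (h : ℂ)).re) = h := by simp [hs]
          have e2 : (s - (h : ℂ)).im = s.im := by simp
          have e3 : 1 + δ - -δ = 1 + 2 * δ := by ring
          rw [e1, e2, e3]
          refine mul_le_mul_of_nonneg_left (Real.log_le_log ?_ ?_) (by linarith)
          · have : h ^ 2 ≤ (1 + 2 * δ) ^ 2 := pow_le_pow_left₀ h0 h1 2
            have := sq_nonneg s.im
            refine mul_pos hm (by linarith)
          · gcongr
            linarith [sq_nonneg h]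
    · refine (hG.left z hz).trans_eq ?_
      congr 2; ring

/-- The price of dividing out a zero at distance `x` from the right edge of a strip of width
`κ`. -/
noncomputable def zeroCost (κ x : ℝ) : ℝ := Real.log ((κ + x) / (κ - x)) / κ

lemma zeroCost_nonneg {κ x : ℝ} (hx : 0 ≤ x) (hxκ : x < κ) : 0 ≤ zeroCost κ x := by
  refine div_nonneg (Real.log_nonneg ?_) (by linarith)
  rw [le_div_iff₀ (by linarith)]; linarith

lemma IsStripBounded.exists_div_zero {δ m A : ℝ} (hδ : 0 < δ) {G : ℂ → ℂ}
    (hG : IsStripBounded δ m A G) {ρ : ℂ} (h0 : 0 < ρ.re) (h1 : ρ.re < 1) (hρ : G ρ = 0) :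
    ∃ F : ℂ → ℂ, IsStripBounded δ m A F ∧ (∀ s, G s = 0 → s ≠ ρ → F s = 0) ∧
      ∀ s, s.re = 1 + δ → ‖F s‖ = ‖G s‖ ∧ (G s ≠ 0 → (logDeriv F s).re = (logDeriv G s).re +
        (zeroCost (1 + 2 * δ) (1 + δ - ρ.re) -
          2 * (1 + δ - ρ.re) / ((1 + δ - ρ.re) ^ 2 + (s.im - ρ.im) ^ 2))) := by
  set c := 1 + δ with hc
  set κ := 1 + 2 * δ with hκ
  set x := c - ρ.re with hx
  have hx0 : 0 < x := by rw [hx, hc]; linarith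
  have hxκ : x < κ := by rw [hx, hc, hκ]; linarith
  set γ := zeroCost κ x with hγ
  have hγ0 : 0 ≤ γ := zeroCost_nonneg hx0.le hxκ
  set ρ' : ℂ := 2 * c - (starRingEnd ℂ) ρ with hρ'
  set P : ℂ → ℂ := fun s ↦ (s - ρ') * cexp (-γ * (c - s)) with hP
  set F : ℂ → ℂ := fun s ↦ dslope G ρ s * P s with hF
  set U := {s : ℂ | -(2 * δ) < s.re ∧ s.re < 1 + 2 * δ} with hU'
  have hU : IsOpen U := isOpen_strip _ _
  have hρU : ρ ∈ U := ⟨by linarith, by linarith⟩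
  have hPd : Differentiable ℂ P := by fun_prop
  have hFd : DifferentiableOn ℂ F U :=
    ((Complex.differentiableOn_dslope (hU.mem_nhds hρU)).2 hG.differentiableOn).mul
      hPd.differentiableOn
  have hFe : ∀ s, s ≠ ρ → F s = G s * (P s / (s - ρ)) := by
    intro s hs
    rw [hF]
    simp only [dslope_of_ne _ hs, slope_def_field, hρ, sub_zero]
    ring
  have hρ'r : ρ'.re = c + x := by rw [hρ']; simp [hx]; ring
  have hρ'i : ρ'.im = ρ.im := by rw [hρ']; simp
  have hPn : ∀ s, ‖P s‖ = ‖s - ρ'‖ * Real.exp (-γ * (c - s.re)) := by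
    intro s
    rw [hP, norm_mul, Complex.norm_exp]
    congr 2
    rw [← Complex.ofReal_neg, Complex.re_ofReal_mul]
    simp
  have hright : ∀ z : ℂ, z.re = c → ‖F z‖ = ‖G z‖ := by
    intro z hz
    have hne : z ≠ ρ := by rintro rfl; linarith
    have hne' : 0 < ‖z - ρ‖ := norm_pos_iff.2 (sub_ne_zero.2 hne)
    have e : ‖z - ρ'‖ = ‖z - ρ‖ := by
      rw [← sq_eq_sq₀ (norm_nonneg _) (norm_nonneg _), ← Complex.normSq_eq_norm_sq,
        ← Complex.normSq_eq_norm_sq, Complex.normSq_apply, Complex.normSq_apply]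
      simp only [Complex.sub_re, Complex.sub_im, hρ'r, hρ'i, hz, hx]
      ring
    rw [hFe z hne, norm_mul, norm_div, hPn, hz, e]
    simp [hne'.ne']
  refine ⟨F, ⟨hFd, ?_, fun z hz ↦ ?_, fun z hz ↦ ?_⟩, fun s hs hsρ ↦ ?_, fun s hs ↦
    ⟨hright s hs, fun hGs ↦ ?_⟩⟩
  · obtain ⟨C, K, hC, hK, hgr⟩ := hG.growth
    have hcomp : IsCompact (Metric.closedBall ρ 1 ∩ {s : ℂ | -δ ≤ s.re ∧ s.re ≤ 1 + δ}) :=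
      (isCompact_closedBall ρ 1).inter_right
        ((isClosed_le continuous_const continuous_re).inter
          (isClosed_le continuous_re continuous_const))
    obtain ⟨M, hM⟩ := hcomp.exists_bound_of_continuousOn (f := F)
      (hFd.continuousOn.mono fun z hz ↦ ⟨by linarith [hz.2.1], by linarith [hz.2.2]⟩)
    refine ⟨C * (1 + 2 * x) + |M|, K, by positivity, hK, fun z g1 g2 g3 ↦ ?_⟩
    have hexp : 1 ≤ Real.exp (K * |z.im|) := Real.one_le_exp (by positivity)
    rcases le_total ‖z - ρ‖ 1 with h | h
    · have := hM z ⟨by simpa [dist_eq_norm] using h, g1, g2⟩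
      calc ‖F z‖ ≤ |M| * 1 := by rw [mul_one]; exact this.trans (le_abs_self _)
        _ ≤ (C * (1 + 2 * x) + |M|) * Real.exp (K * |z.im|) := by
          gcongr
          have : 0 ≤ C * (1 + 2 * x) := by positivity
          linarith
    · have hne : z ≠ ρ := by
        rintro rfl; simp at h; linarith
      have hb : ‖z - ρ'‖ ≤ (1 + 2 * x) * ‖z - ρ‖ := by
        have e : z - ρ' = (z - ρ) + ((-2 * x : ℝ) : ℂ) := by
          apply Complex.ext
          · simp [hρ'r, hx]; ring
          · simp [hρ'i]
        rw [e]
        refine (norm_add_le _ _).trans ?_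
        rw [Complex.norm_real, Real.norm_eq_abs, abs_of_nonpos (by linarith)]
        nlinarith
      rw [hFe z hne, norm_mul, norm_div, hPn]
      have he : Real.exp (-γ * (c - z.re)) ≤ 1 := by
        apply Real.exp_le_one_iff.2
        have : 0 ≤ c - z.re := by linarith
        nlinarith
      calc _ ≤ C * Real.exp (K * |z.im|) * ((1 + 2 * x) * ‖z - ρ‖ * 1 / ‖z - ρ‖) := by
            gcongr; exact hgr z g1 g2 g3
        _ = C * (1 + 2 * x) * Real.exp (K * |z.im|) := by
            have : ‖z - ρ‖ ≠ 0 := by linarith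
            field_simp
        _ ≤ _ := by gcongr; linarith [abs_nonneg M]
  · have hne : z ≠ ρ := by rintro rfl; linarith
    have hne' : 0 < ‖z - ρ‖ := norm_pos_iff.2 (sub_ne_zero.2 hne)
    rw [hFe z hne, norm_mul, norm_div, hPn, hz]
    refine (mul_le_of_le_one_right (norm_nonneg _) ?_).trans (hG.left z hz)
    rw [div_le_one hne']
    have e1 : Real.exp (-γ * (c - -δ)) = (κ - x) / (κ + x) := by
      rw [hγ, zeroCost, show c - -δ = κ by rw [hc, hκ]; ring, neg_mul,
        div_mul_cancel₀ _ (by rw [hκ]; linarith : κ ≠ 0), Real.exp_neg, Real.exp_log]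
      · rw [inv_div]
      · apply div_pos <;> linarith
    rw [e1, ← mul_div_assoc, div_le_iff₀ (by linarith)]
    refine abs_le_of_sq_le_sq' ?_ (by positivity) |>.2
    rw [mul_pow, mul_pow, ← Complex.normSq_eq_norm_sq, ← Complex.normSq_eq_norm_sq,
      Complex.normSq_apply, Complex.normSq_apply]
    simp only [Complex.sub_re, Complex.sub_im, hρ'r, hρ'i, hz]
    have e2 : -δ - (c + x) = -(κ + x) := by rw [hc, hκ]; ring
    have e3 : -δ - ρ.re = -(κ - x) := by rw [hx, hc, hκ]; ring
    rw [e2, e3]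
    have : (κ - x) ^ 2 ≤ (κ + x) ^ 2 := by nlinarith
    nlinarith [mul_le_mul_of_nonneg_right this (sq_nonneg (z.im - ρ.im))]
  · rw [hright z hz]; exact hG.right z hz
  · rw [hFe s hsρ, hs, zero_mul]
  · have hne : s ≠ ρ := by rintro rfl; linarith
    have hsU : s ∈ U := ⟨by linarith, by linarith⟩
    have hev : F =ᶠ[𝓝 s] fun s ↦ G s * (P s / (s - ρ)) := by
      filter_upwards [isOpen_ne.mem_nhds hne] with z hz using hFe z hz
    have hsρ : s - ρ ≠ 0 := sub_ne_zero.2 hne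
    have hsρ' : s - ρ' ≠ 0 := by
      intro h
      have := congrArg Complex.re h
      rw [Complex.sub_re, hρ'r, hs] at this
      simp at this
      linarith
    have hPs : P s ≠ 0 := mul_ne_zero hsρ' (Complex.exp_ne_zero _)
    have hGd : DifferentiableAt ℂ G s :=
      (hG.differentiableOn s hsU).differentiableAt (hU.mem_nhds hsU)
    have hlP : logDeriv P s = 1 / (s - ρ') + γ := by
      have hd : HasDerivAt P (1 * cexp (-γ * (c - s)) +
          (s - ρ') * (cexp (-γ * (c - s)) * (-γ * (-1)))) s := by
        refine HasDerivAt.mul ((hasDerivAt_id s).sub_const ρ') (HasDerivAt.cexp ?_)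
        exact HasDerivAt.const_mul _ ((hasDerivAt_id s).const_sub _)
      rw [logDeriv_apply, hd.deriv, hP]
      have := Complex.exp_ne_zero (-γ * (c - s))
      field_simp
    have hl : logDeriv F s = logDeriv G s + (1 / (s - ρ') + γ - 1 / (s - ρ)) := by
      rw [logDeriv_apply, hev.deriv_eq, hev.eq_of_nhds, ← logDeriv_apply,
        logDeriv_mul (f := G) (g := fun z ↦ P z / (z - ρ)) s hGs (div_ne_zero hPs hsρ) hGd
          (by fun_prop (disch := exact hsρ)),
        logDeriv_div (f := P) (g := fun z ↦ z - ρ) s hPs hsρ (by fun_prop) (by fun_prop), hlP]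
      congr 2
      rw [logDeriv_apply]
      simp
    rw [hl]
    have e1 : s - ρ' = ⟨-x, s.im - ρ.im⟩ := by
      apply Complex.ext
      · simp [hρ'r, hs]
      · simp [hρ'i]
    have e2 : s - ρ = ⟨x, s.im - ρ.im⟩ := by
      apply Complex.ext
      · simp [hx, hs]
      · simp
    rw [Complex.add_re, Complex.sub_re, Complex.add_re, Complex.ofReal_re, e1, e2, one_div, one_div,
      Complex.inv_re, Complex.inv_re, Complex.normSq_mk, Complex.normSq_mk]
    ring

lemma IsStripBounded.exists_div_zeros {δ m A : ℝ} (hδ : 0 < δ) {G : ℂ → ℂ}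
    (hG : IsStripBounded δ m A G) (Z : Finset ℂ)
    (hZ : ∀ ρ ∈ Z, 0 < ρ.re ∧ ρ.re < 1 ∧ G ρ = 0) :
    ∃ F : ℂ → ℂ, IsStripBounded δ m A F ∧ (∀ s, G s = 0 → s ∉ Z → F s = 0) ∧
      ∀ s, s.re = 1 + δ → ‖F s‖ = ‖G s‖ ∧ (G s ≠ 0 → (logDeriv F s).re = (logDeriv G s).re +
        ∑ ρ ∈ Z, (zeroCost (1 + 2 * δ) (1 + δ - ρ.re) -
          2 * (1 + δ - ρ.re) / ((1 + δ - ρ.re) ^ 2 + (s.im - ρ.im) ^ 2))) := by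
  classical
  induction Z using Finset.induction_on with
  | empty => exact ⟨G, hG, fun s hs _ ↦ hs, fun s _ ↦ ⟨rfl, fun _ ↦ by simp⟩⟩
  | insert ρ Z hρ ih =>
    obtain ⟨F, hF, hF0, hFs⟩ := ih fun r hr ↦ hZ r (Finset.mem_insert_of_mem hr)
    obtain ⟨h1, h2, h3⟩ := hZ ρ (Finset.mem_insert_self _ _)
    obtain ⟨F', hF', hF0', hFs'⟩ := hF.exists_div_zero hδ h1 h2 (hF0 ρ h3 hρ)
    refine ⟨F', hF', fun s hs hsZ ↦ ?_, fun s hs ↦ ⟨?_, fun hGs ↦ ?_⟩⟩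
    · rw [Finset.mem_insert, not_or] at hsZ
      exact hF0' s (hF0 s hs hsZ.2) hsZ.1
    · rw [(hFs' s hs).1, (hFs s hs).1]
    · have hFs0 : F s ≠ 0 := by rw [← norm_ne_zero_iff, (hFs s hs).1]; exact norm_ne_zero_iff.2 hGs
      rw [(hFs' s hs).2 hFs0, (hFs s hs).2 hGs, Finset.sum_insert hρ]
      ring

end KadiriZeroFree

namespace KadiriZeroFree

open Filter Set Topology LSeries DirichletCharacter

open scoped ArithmeticFunction.vonMangoldt

/-- The coefficients of `log L(s, χ)`. -/
noncomputable def logCoeff {N : ℕ} (χ : DirichletCharacter ℂ N) (n : ℕ) : ℂ :=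
  Λ n / Real.log n * χ n

lemma norm_logCoeff_le {N : ℕ} (χ : DirichletCharacter ℂ N) (n : ℕ) : ‖logCoeff χ n‖ ≤ 1 := by
  rw [logCoeff, norm_mul]
  refine mul_le_one₀ ?_ (norm_nonneg _) (χ.norm_le_one _)
  rw [← ofReal_div, norm_real, Real.norm_eq_abs, abs_of_nonneg
    (div_nonneg ArithmeticFunction.vonMangoldt_nonneg (Real.log_natCast_nonneg n))]
  exact div_le_one_of_le₀ ArithmeticFunction.vonMangoldt_le_log (Real.log_natCast_nonneg n)

lemma log_mul_logCoeff {N : ℕ} (χ : DirichletCharacter ℂ N) (n : ℕ) :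
    (Real.log n : ℂ) * logCoeff χ n = Λ n * χ n := by
  rw [logCoeff]
  rcases eq_or_ne (Real.log n) 0 with h | h
  · have : Λ n = 0 := le_antisymm (h ▸ ArithmeticFunction.vonMangoldt_le_log)
      ArithmeticFunction.vonMangoldt_nonneg
    simp [h, this]
  · have : (Real.log n : ℂ) ≠ 0 := by exact_mod_cast h
    field_simp

lemma abscissaOfAbsConv_logCoeff_le {N : ℕ} (χ : DirichletCharacter ℂ N) :
    abscissaOfAbsConv (logCoeff χ) ≤ 1 := by
  simpa using LSeries.abscissaOfAbsConv_le_of_le_const_mul_rpow (f := logCoeff χ) (x := 0)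
    ⟨1, fun n _ ↦ by simpa using norm_logCoeff_le χ n⟩

lemma exp_LSeries_logCoeff {N : ℕ} [NeZero N] (χ : DirichletCharacter ℂ N) {s : ℂ}
    (hs : 1 < s.re) : cexp (LSeries (logCoeff χ) s) = LFunction χ s := by
  set U := {s : ℂ | 1 < s.re} with hU
  have hUo : IsOpen U := isOpen_lt continuous_const continuous_re
  have habs : ∀ z ∈ U, abscissaOfAbsConv (logCoeff χ) < z.re := fun z hz ↦
    (abscissaOfAbsConv_logCoeff_le χ).trans_lt (by exact_mod_cast hz)
  have hne : ∀ z ∈ U, LSeries (fun n : ℕ ↦ χ (n : ZMod N)) z ≠ 0 := fun z hz ↦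
    LSeries_ne_zero_of_one_lt_re χ hz
  have hχa : ∀ z ∈ U, abscissaOfAbsConv (fun n : ℕ ↦ χ (n : ZMod N)) < z.re := fun z hz ↦ by
    rw [absicssaOfAbsConv_eq_one (NeZero.ne N)]; exact_mod_cast hz
  have hd : ∀ z ∈ U, HasDerivAt
      (fun z ↦ LSeries (fun n : ℕ ↦ χ (n : ZMod N)) z * cexp (-LSeries (logCoeff χ) z)) 0 z := by
    intro z hz
    have h1 := LSeries_hasDerivAt (hχa z hz)
    have h2 := LSeries_hasDerivAt (habs z hz)
    refine (h1.mul h2.neg.cexp).congr_deriv ?_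
    have h3 := LSeries_twist_vonMangoldt_eq χ hz
    rw [h1.deriv] at h3
    have h4 : logMul (logCoeff χ) = (fun n : ℕ ↦ χ (n : ZMod N)) * (fun n ↦ (Λ n : ℂ)) := by
      funext n
      rw [logMul, ← natCast_log, log_mul_logCoeff, Pi.mul_apply, mul_comm]
    rw [h4, h3]
    field_simp [hne z hz]
    ring
  have hconst : ∀ z ∈ U, LSeries (fun n : ℕ ↦ χ (n : ZMod N)) z * cexp (-LSeries (logCoeff χ) z) =
      LSeries (fun n : ℕ ↦ χ (n : ZMod N)) s * cexp (-LSeries (logCoeff χ) s) := by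
    intro z hz
    have hconv : Convex ℝ U := convex_halfSpace_re_gt 1
    exact hUo.is_const_of_deriv_eq_zero hconv.isPreconnected
      (fun z hz ↦ (hd z hz).differentiableAt.differentiableWithinAt)
      (fun z hz ↦ (hd z hz).deriv) hz hs
  have hlim : Tendsto (fun x : ℝ ↦ LSeries (fun n : ℕ ↦ χ (n : ZMod N)) x * cexp (-LSeries (logCoeff χ) x))
      atTop (𝓝 1) := by
    have t1 := LSeries.tendsto_atTop (f := fun n : ℕ ↦ χ (n : ZMod N))
      (by rw [absicssaOfAbsConv_eq_one (NeZero.ne N)]; exact EReal.coe_lt_top 1)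
    have t2 := LSeries.tendsto_atTop (f := logCoeff χ)
      ((abscissaOfAbsConv_logCoeff_le χ).trans_lt (EReal.coe_lt_top 1))
    have := t1.mul t2.neg.cexp
    simpa [logCoeff] using this
  have hone : LSeries (fun n : ℕ ↦ χ (n : ZMod N)) s * cexp (-LSeries (logCoeff χ) s) = 1 := by
    refine tendsto_nhds_unique (tendsto_const_nhds.congr' ?_) hlim
    filter_upwards [eventually_gt_atTop 1] with x hx
    exact (hconst x (by simpa [hU] using hx)).symm
  rw [LFunction_eq_LSeries χ hs]
  rw [Complex.exp_neg] at hone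
  field_simp [Complex.exp_ne_zero] at hone
  exact hone.symm

/-- Smoothed coefficients of `log L(s, χ)`. -/
noncomputable def dampedCoeff {N : ℕ} (χ : DirichletCharacter ℂ N) (κ : ℝ) (n : ℕ) : ℂ :=
  logCoeff χ n / ((n : ℝ) ^ κ + 1 : ℝ)

lemma norm_dampedCoeff_le {N : ℕ} (χ : DirichletCharacter ℂ N) (κ : ℝ) {n : ℕ} (hn : n ≠ 0) :
    ‖dampedCoeff χ κ n‖ ≤ (n : ℝ) ^ (-κ) := by
  have h : (0 : ℝ) < (n : ℝ) ^ κ := Real.rpow_pos_of_pos (by positivity) _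
  rw [dampedCoeff, norm_div, norm_real, Real.norm_eq_abs, abs_of_pos (by positivity),
    Real.rpow_neg (by positivity), ← one_div]
  exact div_le_div₀ zero_le_one (norm_logCoeff_le χ n) h (by linarith)

lemma conj_dampedCoeff {N : ℕ} [NeZero N] (χ : DirichletCharacter ℂ N) (κ : ℝ) (n : ℕ) :
    (starRingEnd ℂ) (dampedCoeff χ κ n) = dampedCoeff χ⁻¹ κ n := by
  rw [dampedCoeff, dampedCoeff, logCoeff, logCoeff, map_div₀, map_mul, map_div₀, conj_ofReal,
    conj_ofReal, conj_ofReal, conj_apply_dirichletCharacter]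

lemma abscissaOfAbsConv_dampedCoeff_le {N : ℕ} (χ : DirichletCharacter ℂ N) (κ : ℝ) :
    abscissaOfAbsConv (dampedCoeff χ κ) ≤ ((1 - κ : ℝ) : EReal) := by
  have := LSeries.abscissaOfAbsConv_le_of_le_const_mul_rpow (f := dampedCoeff χ κ) (x := -κ)
    ⟨1, fun n hn ↦ by simpa using norm_dampedCoeff_le χ κ hn⟩
  refine this.trans_eq ?_
  rw [show (1 - κ : ℝ) = -κ + 1 by ring]; norm_cast

/-- A holomorphic function on the strip `-2δ < re s < 1 + 2δ` whose real part is `log |L(s, χ)|`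
on the line `re s = 1 + δ`, and symmetric under `s ↦ 1 - conj s`. -/
noncomputable def symLog {N : ℕ} (χ : DirichletCharacter ℂ N) (δ : ℝ) (s : ℂ) : ℂ :=
  LSeries (dampedCoeff χ (1 + 2 * δ)) s + LSeries (dampedCoeff χ⁻¹ (1 + 2 * δ)) (1 - s)

lemma dampedCoeff_abscissa_lt {N : ℕ} (χ : DirichletCharacter ℂ N) {δ : ℝ} {s : ℂ}
    (hs : -(2 * δ) < s.re) : abscissaOfAbsConv (dampedCoeff χ (1 + 2 * δ)) < s.re :=
  (abscissaOfAbsConv_dampedCoeff_le χ _).trans_lt (by rw [EReal.coe_lt_coe_iff]; linarith)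

lemma hasDerivAt_symLog {N : ℕ} (χ : DirichletCharacter ℂ N) {δ : ℝ} {s : ℂ}
    (h1 : -(2 * δ) < s.re) (h2 : s.re < 1 + 2 * δ) :
    HasDerivAt (symLog χ δ) (-LSeries (logMul (dampedCoeff χ (1 + 2 * δ))) s +
      LSeries (logMul (dampedCoeff χ⁻¹ (1 + 2 * δ))) (1 - s)) s := by
  refine (LSeries_hasDerivAt (dampedCoeff_abscissa_lt χ h1)).add ?_
  have h3 := LSeries_hasDerivAt (dampedCoeff_abscissa_lt χ⁻¹ (δ := δ) (s := 1 - s)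
    (by rw [sub_re, one_re]; linarith))
  exact (h3.comp s ((hasDerivAt_id s).const_sub 1)).congr_deriv (by simp)

lemma symLog_one_sub_conj {N : ℕ} [NeZero N] (χ : DirichletCharacter ℂ N) (δ : ℝ) (s : ℂ) :
    symLog χ δ (1 - (starRingEnd ℂ) s) = (starRingEnd ℂ) (symLog χ δ s) := by
  rw [symLog, symLog, map_add, conj_LSeries, conj_LSeries]
  simp_rw [conj_dampedCoeff]
  rw [inv_inv, map_sub, map_one, sub_sub_cancel, add_comm]

lemma exists_norm_symLog_le {N : ℕ} (χ : DirichletCharacter ℂ N) {δ : ℝ} (hδ : 0 < δ) :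
    ∃ M, ∀ s : ℂ, -δ ≤ s.re → s.re ≤ 1 + δ → ‖symLog χ δ s‖ ≤ M := by
  have key : ∀ ψ : DirichletCharacter ℂ N, ∀ s : ℂ, -δ ≤ s.re →
      ‖LSeries (dampedCoeff ψ (1 + 2 * δ)) s‖ ≤
        ∑' n, ‖term (dampedCoeff ψ (1 + 2 * δ)) ((-δ : ℝ) : ℂ) n‖ := by
    intro ψ s hs
    have hsum : LSeriesSummable (dampedCoeff ψ (1 + 2 * δ)) ((-δ : ℝ) : ℂ) :=
      LSeriesSummable_of_abscissaOfAbsConv_lt_re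
        (dampedCoeff_abscissa_lt ψ (by rw [ofReal_re]; linarith))
    exact tsum_of_norm_bounded hsum.norm.hasSum
      fun n ↦ norm_term_le_of_re_le_re _ (by simpa using hs) n
  exact ⟨_, fun s h1 h2 ↦ (norm_add_le _ _).trans (add_le_add (key χ s h1)
    (key χ⁻¹ (1 - s) (by rw [sub_re, one_re]; linarith)))⟩

/-- The weight of `n` in the smoothed sum over primes. -/
noncomputable def vmWeight (δ : ℝ) (n : ℕ) : ℝ :=
  (n : ℝ) ^ (1 + 2 * δ) / ((n : ℝ) ^ (1 + 2 * δ) + 1) * Λ n * (n : ℝ) ^ (-(1 + δ))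

lemma vmWeight_nonneg (δ : ℝ) (n : ℕ) : 0 ≤ vmWeight δ n := by
  have : 0 ≤ Λ n := ArithmeticFunction.vonMangoldt_nonneg
  unfold vmWeight
  positivity

lemma summable_vmWeight {δ : ℝ} (hδ : 0 < δ) : Summable (vmWeight δ) := by
  have h := (ArithmeticFunction.LSeriesSummable_vonMangoldt (s := ((1 + δ : ℝ) : ℂ))
    (by rw [ofReal_re]; linarith)).norm
  refine h.of_nonneg_of_le (vmWeight_nonneg δ) fun n ↦ ?_
  rcases eq_or_ne n 0 with rfl | hn
  · simp [vmWeight]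
  · have h0 : (0 : ℝ) < n := by positivity
    have hΛ : 0 ≤ Λ n := ArithmeticFunction.vonMangoldt_nonneg
    have h1 : 0 < (n : ℝ) ^ (1 + 2 * δ) := Real.rpow_pos_of_pos h0 _
    rw [norm_term_eq, if_neg hn, norm_real, Real.norm_of_nonneg hΛ, vmWeight,
      Real.rpow_neg h0.le, ofReal_re, ← div_eq_mul_inv]
    gcongr
    refine mul_le_of_le_one_left hΛ ((div_le_one (by positivity)).2 (by linarith))

/-- The smoothed sum over primes for `χ` at height `τ`. -/
noncomputable def primeSum {N : ℕ} (χ : DirichletCharacter ℂ N) (δ τ : ℝ) : ℝ :=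
  ∑' n : ℕ, vmWeight δ n * (χ n * cexp (-(τ * Real.log n : ℝ) * I)).re

lemma natCast_cpow_neg_re_add {n : ℕ} (hn : n ≠ 0) (x y : ℝ) :
    (n : ℂ) ^ (-(x + y * I : ℂ)) = ((n : ℝ) ^ (-x) : ℝ) * cexp (-(y * Real.log n : ℝ) * I) := by
  have h0 : (0 : ℝ) < n := by positivity
  have hn' : (n : ℂ) ≠ 0 := by exact_mod_cast hn
  rw [Real.rpow_def_of_pos h0, ofReal_exp, ← Complex.exp_add, Complex.cpow_def_of_ne_zero hn',
    ← natCast_log]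
  congr 1
  push_cast
  ring

lemma term_mul_of_ne_zero (f : ℕ → ℂ) (s : ℂ) {n : ℕ} (hn : n ≠ 0) :
    term f s n = f n * (n : ℂ) ^ (-s) := by
  rw [term_of_ne_zero hn, cpow_neg, div_eq_mul_inv]

lemma re_conj_mul_cexp (a : ℂ) (θ : ℝ) :
    ((starRingEnd ℂ) a * cexp ((θ : ℝ) * I)).re = (a * cexp (-(θ : ℝ) * I)).re := by
  rw [← Complex.conj_re (a * _), map_mul, ← Complex.exp_conj]
  simp

lemma rpow_neg_add_mul {n : ℕ} (hn : n ≠ 0) (δ : ℝ) :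
    (n : ℝ) ^ δ = (n : ℝ) ^ (1 + 2 * δ) * (n : ℝ) ^ (-(1 + δ)) := by
  rw [← Real.rpow_add (by positivity)]
  congr 1
  ring

lemma re_term_symLog {N : ℕ} [NeZero N] (χ : DirichletCharacter ℂ N) {δ : ℝ} {s : ℂ}
    (hs : s.re = 1 + δ) (c : ℕ → ℝ) {n : ℕ} (hn : n ≠ 0) :
    (term (fun n ↦ c n * dampedCoeff χ (1 + 2 * δ) n) s n).re =
      c n * (1 / ((n : ℝ) ^ (1 + 2 * δ) + 1)) * (n : ℝ) ^ (-(1 + δ)) *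
        (logCoeff χ n * cexp (-(s.im * Real.log n : ℝ) * I)).re ∧
    (term (fun n ↦ c n * dampedCoeff χ⁻¹ (1 + 2 * δ) n) (1 - s) n).re =
      c n * ((n : ℝ) ^ (1 + 2 * δ) / ((n : ℝ) ^ (1 + 2 * δ) + 1)) * (n : ℝ) ^ (-(1 + δ)) *
        (logCoeff χ n * cexp (-(s.im * Real.log n : ℝ) * I)).re := by
  have hs1 : s = ((1 + δ : ℝ) : ℂ) + s.im * I := by
    rw [← hs]; exact (Complex.re_add_im s).symm
  have hs2 : 1 - s = ((-δ : ℝ) : ℂ) + ((-s.im : ℝ) : ℂ) * I := by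
    apply Complex.ext <;> simp [hs]
  set w : ℝ := (n : ℝ) ^ (1 + 2 * δ) with hw
  constructor
  · rw [term_mul_of_ne_zero _ _ hn]
    conv_lhs => rw [hs1]
    rw [natCast_cpow_neg_re_add hn, dampedCoeff, ← hw,
      show (c n : ℂ) * (logCoeff χ n / ((w + 1 : ℝ) : ℂ)) * (((n : ℝ) ^ (-(1 + δ)) : ℝ) *
        cexp (-(s.im * Real.log n : ℝ) * I)) =
        ((c n * (1 / (w + 1)) * (n : ℝ) ^ (-(1 + δ)) : ℝ) : ℂ) *
          (logCoeff χ n * cexp (-(s.im * Real.log n : ℝ) * I)) by push_cast; ring,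
      Complex.re_ofReal_mul]
  · rw [term_mul_of_ne_zero _ _ hn, hs2, natCast_cpow_neg_re_add hn, neg_neg,
      rpow_neg_add_mul hn δ, ← hw]
    have e : dampedCoeff χ⁻¹ (1 + 2 * δ) n = (1 / (w + 1) : ℝ) * (starRingEnd ℂ) (logCoeff χ n) := by
      rw [← conj_dampedCoeff, dampedCoeff, map_div₀, conj_ofReal, ← hw]
      push_cast; ring
    rw [e, show (c n : ℂ) * ((1 / (w + 1) : ℝ) * (starRingEnd ℂ) (logCoeff χ n)) *
        ((w * (n : ℝ) ^ (-(1 + δ)) : ℝ) * cexp (-(-s.im * Real.log n : ℝ) * I)) =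
        ((c n * (w / (w + 1)) * (n : ℝ) ^ (-(1 + δ)) : ℝ) : ℂ) *
          ((starRingEnd ℂ) (logCoeff χ n) * cexp ((s.im * Real.log n : ℝ) * I)) by
        push_cast; ring_nf, Complex.re_ofReal_mul, re_conj_mul_cexp]

lemma exp_re_symLog {N : ℕ} [NeZero N] (χ : DirichletCharacter ℂ N) {δ : ℝ} (hδ : 0 < δ) {s : ℂ}
    (hs : s.re = 1 + δ) : Real.exp (symLog χ δ s).re = ‖LFunction χ s‖ := by
  rw [← exp_LSeries_logCoeff χ (by linarith), Complex.norm_exp]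
  congr 1
  have s1 : LSeriesSummable (dampedCoeff χ (1 + 2 * δ)) s :=
    LSeriesSummable_of_abscissaOfAbsConv_lt_re (dampedCoeff_abscissa_lt χ (by linarith))
  have s2 : LSeriesSummable (dampedCoeff χ⁻¹ (1 + 2 * δ)) (1 - s) :=
    LSeriesSummable_of_abscissaOfAbsConv_lt_re
      (dampedCoeff_abscissa_lt χ⁻¹ (by rw [sub_re, one_re]; linarith))
  have s3 : LSeriesSummable (logCoeff χ) s := LSeriesSummable_of_abscissaOfAbsConv_lt_re
    ((abscissaOfAbsConv_logCoeff_le χ).trans_lt (by exact_mod_cast (by linarith : 1 < s.re)))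
  rw [symLog, Complex.add_re, LSeries, LSeries, LSeries, Complex.re_tsum s1, Complex.re_tsum s2,
    Complex.re_tsum s3, ← ((Complex.hasSum_re s1.hasSum).summable.tsum_add
      (Complex.hasSum_re s2.hasSum).summable)]
  refine tsum_congr fun n ↦ ?_
  rcases eq_or_ne n 0 with rfl | hn
  · simp
  have := re_term_symLog χ hs (fun _ ↦ 1) hn
  simp only [ofReal_one, one_mul] at this
  have hs1 : s = ((1 + δ : ℝ) : ℂ) + s.im * I := by
    rw [← hs]; exact (Complex.re_add_im s).symm
  rw [this.1, this.2, term_mul_of_ne_zero _ _ hn]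
  conv_rhs => rw [hs1]
  rw [natCast_cpow_neg_re_add hn, mul_left_comm, Complex.re_ofReal_mul]
  have h0 : 0 < (n : ℝ) ^ (1 + 2 * δ) := Real.rpow_pos_of_pos (by positivity) _
  field_simp
  ring

lemma re_deriv_symLog {N : ℕ} [NeZero N] (χ : DirichletCharacter ℂ N) {δ : ℝ} (hδ : 0 < δ) {s : ℂ}
    (hs : s.re = 1 + δ) :
    (logDeriv (LFunction χ) s - deriv (symLog χ δ) s).re = -(2 * primeSum χ δ s.im) := by
  have hs' : 1 < s.re := by linarith
  have e1 : ∀ ψ : DirichletCharacter ℂ N, logMul (dampedCoeff ψ (1 + 2 * δ)) =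
      fun n : ℕ ↦ (Real.log n : ℂ) * dampedCoeff ψ (1 + 2 * δ) n := fun ψ ↦ by
    funext n; rw [logMul, ← natCast_log]
  have s1 : LSeriesSummable (logMul (dampedCoeff χ (1 + 2 * δ))) s :=
    LSeriesSummable_logMul_of_lt_re (dampedCoeff_abscissa_lt χ (by linarith))
  have s2 : LSeriesSummable (logMul (dampedCoeff χ⁻¹ (1 + 2 * δ))) (1 - s) :=
    LSeriesSummable_logMul_of_lt_re
      (dampedCoeff_abscissa_lt χ⁻¹ (by rw [sub_re, one_re]; linarith))
  have s3 := DirichletCharacter.LSeriesSummable_twist_vonMangoldt χ hs'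
  rw [(hasDerivAt_symLog χ (by linarith) (by linarith)).deriv, logDeriv_apply,
    deriv_LFunction_eq_deriv_LSeries χ hs', LFunction_eq_LSeries χ hs',
    show deriv (LSeries fun n : ℕ ↦ χ n) s / LSeries (fun n : ℕ ↦ χ n) s =
        -LSeries ((fun n : ℕ ↦ χ n) * fun n : ℕ ↦ (Λ n : ℂ)) s by
      rw [LSeries_twist_vonMangoldt_eq χ hs', neg_div, neg_neg]]
  rw [Complex.sub_re, Complex.add_re, Complex.neg_re, Complex.neg_re, LSeries, LSeries, LSeries,
    Complex.re_tsum s1, Complex.re_tsum s2, Complex.re_tsum s3, primeSum, ← tsum_mul_left]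
  have h1 := (Complex.hasSum_re s1.hasSum).summable
  have h2 := (Complex.hasSum_re s2.hasSum).summable
  have h3 := (Complex.hasSum_re s3.hasSum).summable
  rw [← neg_inj, neg_neg, neg_sub', neg_neg, sub_neg_eq_add, neg_add_eq_sub]
  rw [← h2.tsum_sub h1, ← h3.tsum_add (h2.sub h1)]
  refine tsum_congr fun n ↦ ?_
  rcases eq_or_ne n 0 with rfl | hn
  · simp [vmWeight]
  have := re_term_symLog χ hs (fun n ↦ Real.log n) hn
  rw [e1, e1, this.1, this.2, vmWeight, term_mul_of_ne_zero _ _ hn]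
  have hs1 : s = ((1 + δ : ℝ) : ℂ) + s.im * I := by
    rw [← hs]; exact (Complex.re_add_im s).symm
  conv_lhs => enter [1]; rw [hs1]
  set E := cexp (-(s.im * Real.log n : ℝ) * I) with hE
  have h5 : Real.log n * (logCoeff χ n * E).re = Λ n * (χ n * E).re := by
    rw [← Complex.re_ofReal_mul, ← mul_assoc, log_mul_logCoeff, mul_assoc, Complex.re_ofReal_mul]
  rw [natCast_cpow_neg_re_add hn, Pi.mul_apply, show χ n * (Λ n : ℂ) * (((n : ℝ) ^ (-(1 + δ)) : ℝ) *
    E) = ((Λ n * (n : ℝ) ^ (-(1 + δ)) : ℝ) : ℂ) * (χ n * E) by push_cast; ring,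
    Complex.re_ofReal_mul]
  have h0 : 0 < (n : ℝ) ^ (1 + 2 * δ) := Real.rpow_pos_of_pos (by positivity) _
  set w := (n : ℝ) ^ (1 + 2 * δ)
  set v := (n : ℝ) ^ (-(1 + δ))
  have h6 : w + 1 ≠ 0 := by positivity
  rw [show Real.log n * (w / (w + 1)) * v * (logCoeff χ n * E).re =
    (w / (w + 1)) * v * (Real.log n * (logCoeff χ n * E).re) by ring,
    show Real.log n * (1 / (w + 1)) * v * (logCoeff χ n * E).re =
    (1 / (w + 1)) * v * (Real.log n * (logCoeff χ n * E).re) by ring, h5]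
  field_simp
  ring

lemma isStripBounded_mul_exp_symLog {N : ℕ} [NeZero N] {χ : DirichletCharacter ℂ N}
    (hχ : χ.IsPrimitive) {δ : ℝ} (hδ : 0 < δ) (hδ' : δ ≤ 3 / 2) {P : ℂ → ℂ}
    (hP : DifferentiableOn ℂ P {s | -(2 * δ) < s.re ∧ s.re < 1 + 2 * δ})
    (hgr : ∃ C K : ℝ, 0 ≤ C ∧ 0 ≤ K ∧ ∀ z : ℂ, -δ ≤ z.re → z.re ≤ 1 + δ → 1 ≤ |z.im| →
      ‖P z‖ ≤ C * Real.exp (K * |z.im|))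
    (hl : ∀ z : ℂ, z.re = -δ → ‖P z‖ ≤ ‖LFunction χ z‖)
    (hr : ∀ z : ℂ, z.re = 1 + δ → ‖P z‖ = ‖LFunction χ z‖) :
    IsStripBounded δ ((N / (2 * π)) ^ 2) (5 / 2) (fun s ↦ P s * cexp (-symLog χ δ s)) ∧
      ∀ z : ℂ, z.re = 1 + δ → ‖P z * cexp (-symLog χ δ z)‖ = 1 := by
  have hright : ∀ z : ℂ, z.re = 1 + δ → ‖P z * cexp (-symLog χ δ z)‖ = 1 := by
    intro z hz
    have h0 : ‖LFunction χ z‖ ≠ 0 := by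
      rw [← exp_re_symLog χ hδ hz]; exact (Real.exp_pos _).ne'
    rw [norm_mul, Complex.norm_exp, Complex.neg_re, Real.exp_neg, exp_re_symLog χ hδ hz, hr z hz,
      mul_inv_cancel₀ h0]
  refine ⟨⟨?_, ?_, fun z hz ↦ ?_, fun z hz ↦ (hright z hz).le⟩, hright⟩
  · exact hP.mul (DifferentiableOn.cexp (DifferentiableOn.neg fun s hs ↦
      (hasDerivAt_symLog χ hs.1 hs.2).differentiableAt.differentiableWithinAt))
  · obtain ⟨M, hM⟩ := exists_norm_symLog_le χ hδ
    obtain ⟨C, K, hC, hK, h⟩ := hgr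
    refine ⟨C * Real.exp M, K, by positivity, hK, fun z h1 h2 h3 ↦ ?_⟩
    rw [norm_mul, Complex.norm_exp, mul_right_comm]
    refine mul_le_mul (h z h1 h2 h3) (Real.exp_le_exp.2 ?_) (Real.exp_pos _).le (by positivity)
    exact (Complex.re_le_norm _).trans ((norm_neg _).trans_le (hM z h1 h2))
  · set z' := 1 - (starRingEnd ℂ) z with hz'
    have hz'r : z'.re = 1 + δ := by simp [hz', hz]
    have e : (symLog χ δ z).re = (symLog χ δ z').re := by
      rw [hz', symLog_one_sub_conj, Complex.conj_re]
    have h0 : 0 < ‖LFunction χ z'‖ := by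
      rw [← exp_re_symLog χ hδ hz'r]; exact Real.exp_pos _
    rw [norm_mul, Complex.norm_exp, Complex.neg_re, Real.exp_neg, e, exp_re_symLog χ hδ hz'r,
      ← div_eq_mul_inv, div_le_iff₀ h0]
    exact (hl z hz).trans (norm_LFunction_le_of_re_eq hχ hδ hδ' hz)

lemma two_mul_primeSum_le_of_base {N : ℕ} [NeZero N] {χ : DirichletCharacter ℂ N}
    (hχ : χ.IsPrimitive) {δ : ℝ} (hδ : 0 < δ) (hδ' : δ ≤ 3 / 2) {P : ℂ → ℂ}
    (hP : DifferentiableOn ℂ P {s | -(2 * δ) < s.re ∧ s.re < 1 + 2 * δ})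
    (hgr : ∃ C K : ℝ, 0 ≤ C ∧ 0 ≤ K ∧ ∀ z : ℂ, -δ ≤ z.re → z.re ≤ 1 + δ → 1 ≤ |z.im| →
      ‖P z‖ ≤ C * Real.exp (K * |z.im|))
    (hl : ∀ z : ℂ, z.re = -δ → ‖P z‖ ≤ ‖LFunction χ z‖)
    (hr : ∀ z : ℂ, z.re = 1 + δ → ‖P z‖ = ‖LFunction χ z‖)
    {s e : ℂ} (hs : s.re = 1 + δ) (he : logDeriv P s = logDeriv (LFunction χ) s + e)
    (Z : Finset ℂ) (hZ : ∀ ρ ∈ Z, 0 < ρ.re ∧ ρ.re < 1 ∧ P ρ = 0) :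
    2 * primeSum χ δ s.im ≤
      1 / 4 * Real.log ((N / (2 * π)) ^ 2 * (5 / 2 + s.im ^ 2 + (1 + 2 * δ) ^ 2 / 3)) + e.re +
      ∑ ρ ∈ Z, (zeroCost (1 + 2 * δ) (1 + δ - ρ.re) -
          2 * (1 + δ - ρ.re) / ((1 + δ - ρ.re) ^ 2 + (s.im - ρ.im) ^ 2)) := by
  have hN : (0 : ℝ) < N := by exact_mod_cast NeZero.pos N
  obtain ⟨hG, hG1⟩ := isStripBounded_mul_exp_symLog hχ hδ hδ' hP hgr hl hr
  obtain ⟨F, hF, -, hFs⟩ := hG.exists_div_zeros hδ Z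
    fun ρ hρ ↦ ⟨(hZ ρ hρ).1, (hZ ρ hρ).2.1, by rw [(hZ ρ hρ).2.2, zero_mul]⟩
  obtain ⟨h1, h2⟩ := hFs s hs
  have hPE := norm_ne_zero_iff.1 ((hG1 s hs).trans_ne one_ne_zero)
  have hk := hF.neg_re_logDeriv_le hδ (by positivity) (by norm_num) hs (h1.trans (hG1 s hs))
  rw [h2 hPE] at hk
  have hPs : DifferentiableAt ℂ P s := (hP s ⟨by linarith, by linarith⟩).differentiableAt
    ((isOpen_strip _ _).mem_nhds ⟨by linarith, by linarith⟩)
  have hD := hasDerivAt_symLog χ (δ := δ) (s := s) (by linarith) (by linarith)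
  have hlog : logDeriv (fun s ↦ P s * cexp (-symLog χ δ s)) s =
      logDeriv (LFunction χ) s - deriv (symLog χ δ) s + e := by
    have hE : HasDerivAt (fun s ↦ cexp (-symLog χ δ s)) _ s := hD.neg.cexp
    rw [logDeriv_mul (f := P) (g := fun s ↦ cexp (-symLog χ δ s)) s (left_ne_zero_of_mul hPE)
      (Complex.exp_ne_zero _) hPs hE.differentiableAt, he, logDeriv_apply,
      logDeriv_apply, hE.deriv, hD.deriv, Pi.neg_apply, mul_div_cancel_left₀ _ (Complex.exp_ne_zero _)]
    ring
  rw [hlog, Complex.add_re, re_deriv_symLog χ hδ hs] at hk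
  linarith

/-- The basic inequality for the smoothed prime sum of a primitive character. -/
lemma two_mul_primeSum_le {N : ℕ} [NeZero N] {χ : DirichletCharacter ℂ N}
    (hχ : χ.IsPrimitive) {δ : ℝ} (hδ : 0 < δ) (hδ' : δ ≤ 3 / 2) (τ : ℝ)
    (Z : Finset ℂ) (hZ : ∀ ρ ∈ Z, 0 < ρ.re ∧ ρ.re < 1 ∧ LFunction χ ρ = 0) :
    2 * primeSum χ δ τ ≤
      1 / 4 * Real.log ((N / (2 * π)) ^ 2 * (5 / 2 + τ ^ 2 + (1 + 2 * δ) ^ 2 / 3)) +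
      (if N = 1 then 2 * δ / (δ ^ 2 + τ ^ 2) else 0) +
      ∑ ρ ∈ Z, (zeroCost (1 + 2 * δ) (1 + δ - ρ.re) -
          2 * (1 + δ - ρ.re) / ((1 + δ - ρ.re) ^ 2 + (τ - ρ.im) ^ 2)) := by
  obtain ⟨C, hC⟩ := exists_norm_LFunction_le χ (-δ) (1 + δ)
  set s : ℂ := ((1 + δ : ℝ) : ℂ) + τ * I with hs
  have hsr : s.re = 1 + δ := by simp [hs]
  have hsi : s.im = τ := by simp [hs]
  split_ifs with hN1
  · subst hN1
    obtain rfl : χ = 1 := Subsingleton.elim _ _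
    have hL₁ : ∀ z : ℂ, z ≠ 1 → LFunctionTrivChar₁ 1 z =
        (z - 1) * LFunction (1 : DirichletCharacter ℂ 1) z := fun z hz ↦ Function.update_of_ne hz _ _
    set P : ℂ → ℂ := fun z ↦ LFunctionTrivChar₁ 1 z / (z - (1 + 2 * δ : ℝ)) with hP
    have hden : ∀ z : ℂ, z.re < 1 + 2 * δ → z - (1 + 2 * δ : ℝ) ≠ 0 := by
      intro z hz h
      have := congrArg Complex.re h
      rw [Complex.sub_re, ofReal_re, Complex.zero_re] at this
      linarith
    have hratio : ∀ z : ℂ, z.re ≤ 1 + δ → ‖z - 1‖ ≤ ‖z - (1 + 2 * δ : ℝ)‖ := by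
      intro z hz
      rw [← sq_le_sq₀ (norm_nonneg _) (norm_nonneg _), ← Complex.normSq_eq_norm_sq,
        ← Complex.normSq_eq_norm_sq, Complex.normSq_apply, Complex.normSq_apply]
      simp only [Complex.sub_re, Complex.sub_im, ofReal_re, ofReal_im, one_re, one_im]
      nlinarith
    have hPe : ∀ z : ℂ, z ≠ 1 → ‖P z‖ = ‖z - 1‖ / ‖z - (1 + 2 * δ : ℝ)‖ *
        ‖LFunction (1 : DirichletCharacter ℂ 1) z‖ := by
      intro z hz
      rw [hP]
      simp only
      rw [hL₁ z hz, norm_div, norm_mul]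
      ring
    have hPle : ∀ z : ℂ, z ≠ 1 → z.re ≤ 1 + δ →
        ‖P z‖ ≤ ‖LFunction (1 : DirichletCharacter ℂ 1) z‖ := by
      intro z hz hz'
      rw [hPe z hz]
      exact mul_le_of_le_one_left (norm_nonneg _) (div_le_one_of_le₀ (hratio z hz') (norm_nonneg _))
    have hne : ∀ z : ℂ, z.re ≠ 1 → z ≠ 1 := by rintro z hz rfl; simp at hz
    have hs1 : s ≠ 1 := hne s (by rw [hsr]; linarith)
    have hs2 : s - (1 + 2 * δ : ℝ) ≠ 0 := hden s (by linarith)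
    have hLs : LFunction (1 : DirichletCharacter ℂ 1) s ≠ 0 := by
      rw [← norm_ne_zero_iff, ← exp_re_symLog _ hδ hsr]; exact (Real.exp_pos _).ne'
    have hlog : logDeriv P s = logDeriv (LFunction (1 : DirichletCharacter ℂ 1)) s +
        (1 / (s - 1) - 1 / (s - (1 + 2 * δ : ℝ))) := by
      have hd := differentiableAt_LFunction (1 : DirichletCharacter ℂ 1) s (Or.inl hs1)
      have h1 : LFunctionTrivChar₁ 1 =ᶠ[𝓝 s]
          fun z ↦ (z - 1) * LFunction (1 : DirichletCharacter ℂ 1) z := by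
        filter_upwards [isOpen_ne.mem_nhds hs1] with z hz using hL₁ z hz
      rw [hP, logDeriv_div (f := LFunctionTrivChar₁ 1) (g := fun z ↦ z - (1 + 2 * δ : ℝ)) s
        (by rw [hL₁ s hs1]; exact mul_ne_zero (sub_ne_zero.2 hs1) hLs) hs2
        (differentiable_LFunctionTrivChar₁ 1 s) (by fun_prop), logDeriv_apply, h1.deriv_eq,
        h1.eq_of_nhds, ← logDeriv_apply,
        logDeriv_mul (f := fun z ↦ z - 1) (g := LFunction (1 : DirichletCharacter ℂ 1)) s
          (sub_ne_zero.2 hs1) hLs (by fun_prop) hd]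
      simp [logDeriv_apply]
      ring
    have hre : (1 / (s - 1) - 1 / (s - (1 + 2 * δ : ℝ))).re = 2 * δ / (δ ^ 2 + τ ^ 2) := by
      have a1 : s - 1 = ⟨δ, τ⟩ := by apply Complex.ext <;> simp [hs]
      have a2 : s - (1 + 2 * δ : ℝ) = ⟨-δ, τ⟩ := by
        apply Complex.ext
        · rw [Complex.sub_re, hsr, ofReal_re]; ring
        · rw [Complex.sub_im, hsi, ofReal_im, sub_zero]
      rw [a1, a2, one_div, one_div, Complex.sub_re, Complex.inv_re, Complex.inv_re,
        Complex.normSq_mk, Complex.normSq_mk]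
      ring
    have := two_mul_primeSum_le_of_base hχ hδ hδ' (P := P) ?_
      ⟨|C|, π, abs_nonneg _, Real.pi_pos.le, fun z h1 h2 h3 ↦ ?_⟩ (fun z hz ↦ ?_) (fun z hz ↦ ?_)
      hsr hlog Z fun ρ hρ ↦ ⟨(hZ ρ hρ).1, (hZ ρ hρ).2.1, ?_⟩
    · rwa [hre, hsi] at this
    · exact (differentiable_LFunctionTrivChar₁ 1).differentiableOn.div (by fun_prop)
        fun z hz ↦ hden z hz.2
    · refine (hPle z (by rintro rfl; norm_num at h3) h2).trans ((hC z h1 h2 h3).trans ?_)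
      gcongr; exact le_abs_self C
    · exact hPle z (hne z (by linarith)) (by linarith)
    · rw [hPe z (hne z (by linarith)), div_eq_one_iff_eq ?_ |>.2, one_mul]
      · rw [← sq_eq_sq₀ (norm_nonneg _) (norm_nonneg _), ← Complex.normSq_eq_norm_sq,
          ← Complex.normSq_eq_norm_sq, Complex.normSq_apply, Complex.normSq_apply]
        simp only [Complex.sub_re, Complex.sub_im, ofReal_re, ofReal_im, one_re, one_im, hz]
        ring
      · exact norm_ne_zero_iff.2 (hden z (by linarith))
    · rw [hP]
      simp only
      rw [hL₁ ρ (hne ρ (hZ ρ hρ).2.1.ne), (hZ ρ hρ).2.2, mul_zero, zero_div]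
  · have hχ1 : χ ≠ 1 := by
      rintro rfl
      rw [isPrimitive_def, conductor_one] at hχ
      exact hN1 hχ.symm
    have := two_mul_primeSum_le_of_base hχ hδ hδ' (P := LFunction χ)
      (differentiable_LFunction hχ1).differentiableOn
      ⟨|C|, π, abs_nonneg _, Real.pi_pos.le, fun z h1 h2 h3 ↦ (hC z h1 h2 h3).trans ?_⟩
      (fun z _ ↦ le_rfl) (fun z _ ↦ rfl) hsr (add_zero _).symm Z hZ
    · rwa [hsi, Complex.zero_re] at this
    · gcongr; exact le_abs_self C

lemma apply_unit_eq_primitiveCharacter {q d n : ℕ} (ψ : DirichletCharacter ℂ q) (hd : d ∣ q)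
    (hψ : ψ.conductor ∣ d) (hn : n.Coprime d) {u : (ZMod q)ˣ}
    (hu : ZMod.unitsMap hd u = ZMod.unitOfCoprime n hn) :
    ψ u = ψ.primitiveCharacter (n : ZMod ψ.conductor) := by
  conv_lhs => rw [← changeLevel_primitiveCharacter ψ]
  rw [changeLevel_eq_cast_of_dvd, ← ZMod.unitsMap_val ψ.conductor_dvd_level]
  have h1 : ZMod.unitsMap ψ.conductor_dvd_level u =
      ZMod.unitsMap hψ (ZMod.unitOfCoprime n hn) := by
    rw [← hu, ← MonoidHom.comp_apply, ZMod.unitsMap_comp]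
  rw [h1, ZMod.unitsMap_def, Units.coe_map, ZMod.coe_unitOfCoprime]
  simp

/-- On a prime power, the values of all primitive characters of conductor dividing `q` are
simultaneous averages of the values of the characters modulo `q` over a set of units. -/
lemma exists_finset_sum_units_eq (q : ℕ) [NeZero q] {n : ℕ} (hn : IsPrimePow n) :
    ∃ U : Finset (ZMod q)ˣ, U.Nonempty ∧ ∀ ψ : DirichletCharacter ℂ q,
      ∑ u ∈ U, ψ u = U.card * ψ.primitiveCharacter (n : ZMod ψ.conductor) := by
  classical
  obtain ⟨p, m, hp, hm, rfl⟩ := (isPrimePow_nat_iff n).1 hn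
  set d := q / p ^ q.factorization p with hd_def
  have hd : d ∣ q := Nat.ordCompl_dvd q p
  have hpd : p.Coprime d := Nat.coprime_ordCompl hp (NeZero.ne q)
  have hn' : (p ^ m).Coprime d := hpd.pow_left m
  refine ⟨Finset.univ.filter (fun u ↦ ZMod.unitsMap hd u = ZMod.unitOfCoprime _ hn'), ?_, ?_⟩
  · obtain ⟨u, hu⟩ := ZMod.unitsMap_surjective hd (ZMod.unitOfCoprime _ hn')
    exact ⟨u, by simp [hu]⟩
  intro ψ
  by_cases hpf : p ∣ ψ.conductor
  · have h0 : ψ.primitiveCharacter ((p ^ m : ℕ) : ZMod ψ.conductor) = 0 := by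
      apply MulChar.map_nonunit
      rw [ZMod.isUnit_iff_coprime]
      intro h
      have := (Nat.Coprime.coprime_dvd_left (dvd_pow_self p hm.ne') h)
      exact hp.one_lt.ne' (Nat.Coprime.eq_one_of_dvd this hpf)
    have hnf : ¬ ψ.FactorsThrough d := fun h ↦ by
      have h2 : ψ.conductor ∣ d := conductor_dvd_of_mem_conductorSet ψ h
      exact hp.one_lt.ne' (Nat.Coprime.eq_one_of_dvd hpd (hpf.trans h2))
    rw [factorsThrough_iff_ker_unitsMap hd] at hnf
    obtain ⟨k, hk1, hk2⟩ := SetLike.not_le_iff_exists.1 hnf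
    rw [MonoidHom.mem_ker] at hk1 hk2
    have hk3 : ψ (k : ZMod q) ≠ 1 := by
      intro h
      apply hk2
      ext
      simpa using h
    have h1 : ∑ u ∈ Finset.univ.filter (fun u ↦ ZMod.unitsMap hd u = ZMod.unitOfCoprime _ hn'),
        ψ u = ψ k * ∑ u ∈ Finset.univ.filter
          (fun u ↦ ZMod.unitsMap hd u = ZMod.unitOfCoprime _ hn'), ψ u := by
      rw [Finset.mul_sum]
      refine Finset.sum_bij' (fun u _ ↦ k⁻¹ * u) (fun u _ ↦ k * u) ?_ ?_ ?_ ?_ ?_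
      · intro u hu
        simpa [hk1] using hu
      · intro u hu
        simpa [hk1] using hu
      · simp
      · simp
      · intro u _
        rw [← map_mul, ← Units.val_mul, mul_inv_cancel_left]
    rw [h0, mul_zero]
    have h2 : (1 - ψ k) * ∑ u ∈ Finset.univ.filter
          (fun u ↦ ZMod.unitsMap hd u = ZMod.unitOfCoprime _ hn'), ψ u = 0 := by
      linear_combination h1
    exact (mul_eq_zero.1 h2).resolve_left (sub_ne_zero.2 hk3.symm)
  · have hc : ψ.conductor ∣ d := by
      have h1 : ψ.conductor ∣ p ^ q.factorization p * d := by
        rw [hd_def, Nat.ordProj_mul_ordCompl_eq_self]; exact ψ.conductor_dvd_level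
      refine Nat.Coprime.dvd_of_dvd_mul_left ?_ h1
      exact Nat.Coprime.pow_right _ ((Nat.Prime.coprime_iff_not_dvd hp).2 hpf).symm
    rw [Finset.sum_congr rfl (fun u hu ↦ apply_unit_eq_primitiveCharacter ψ hd hc hn'
      (Finset.mem_filter.1 hu).2), Finset.sum_const, nsmul_eq_mul]

lemma norm_re_apply_mul_cexp_le {N : ℕ} (χ : DirichletCharacter ℂ N) (n : ℕ) (x : ℝ) :
    ‖(χ n * cexp (-(x : ℝ) * I)).re‖ ≤ 1 := by
  rw [Real.norm_eq_abs]
  refine (Complex.abs_re_le_norm _).trans ?_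
  rw [norm_mul, ← ofReal_neg, Complex.norm_exp_ofReal_mul_I, mul_one]
  exact χ.norm_le_one _

lemma summable_primeSum {N : ℕ} (χ : DirichletCharacter ℂ N) {δ : ℝ} (hδ : 0 < δ) (τ : ℝ) :
    Summable fun n : ℕ ↦ vmWeight δ n * (χ n * cexp (-(τ * Real.log n : ℝ) * I)).re := by
  refine Summable.of_norm_bounded (summable_vmWeight hδ) fun n ↦ ?_
  rw [norm_mul, Real.norm_of_nonneg (vmWeight_nonneg δ n)]
  exact mul_le_of_le_one_right (vmWeight_nonneg δ n) (norm_re_apply_mul_cexp_le χ n _)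

/-- A trigonometric combination of characters modulo `q` that is non-negative on all units
gives a non-negative combination of prime sums over the inducing primitive characters. -/
lemma sum_mul_primeSum_nonneg {q : ℕ} [NeZero q] {ι : Type*} (s : Finset ι) (c : ι → ℝ)
    (ψ : ι → DirichletCharacter ℂ q) (τ : ι → ℝ) {δ : ℝ} (hδ : 0 < δ)
    (h : ∀ (u : (ZMod q)ˣ) (θ : ℝ),
      0 ≤ ∑ i ∈ s, c i * (ψ i u * cexp (-(τ i * θ : ℝ) * I)).re) :
    0 ≤ ∑ i ∈ s, c i * primeSum (ψ i).primitiveCharacter δ (τ i) := by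
  simp only [primeSum, ← tsum_mul_left]
  rw [← Summable.tsum_finsetSum fun i _ ↦ (summable_primeSum _ hδ _).mul_left _]
  refine tsum_nonneg fun n ↦ ?_
  have h1 : ∑ i ∈ s, c i * (vmWeight δ n * ((ψ i).primitiveCharacter n *
      cexp (-(τ i * Real.log n : ℝ) * I)).re) = vmWeight δ n * ∑ i ∈ s, c i *
        ((ψ i).primitiveCharacter n * cexp (-(τ i * Real.log n : ℝ) * I)).re := by
    rw [Finset.mul_sum]
    exact Finset.sum_congr rfl fun i _ ↦ by ring
  rw [h1]
  by_cases hn : IsPrimePow n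
  · refine mul_nonneg (vmWeight_nonneg δ n) ?_
    obtain ⟨U, hU, hU'⟩ := exists_finset_sum_units_eq q hn
    have hc : (0 : ℝ) < U.card := by exact_mod_cast hU.card_pos
    refine (mul_nonneg_iff_of_pos_left hc).1 ?_
    calc 0 ≤ ∑ u ∈ U, ∑ i ∈ s, c i * (ψ i u * cexp (-(τ i * Real.log n : ℝ) * I)).re :=
          Finset.sum_nonneg fun u _ ↦ h u _
      _ = _ := by
        rw [Finset.sum_comm, Finset.mul_sum]
        refine Finset.sum_congr rfl fun i _ ↦ ?_
        rw [← Finset.mul_sum, ← Complex.re_sum, ← Finset.sum_mul, hU' (ψ i), mul_assoc,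
          ← ofReal_natCast, Complex.re_ofReal_mul]
        ring
  · have : Λ n = 0 := by
      rw [ArithmeticFunction.vonMangoldt_apply, if_neg hn]
    simp [vmWeight, this]

lemma LFunction_primitiveCharacter_eq_zero {q : ℕ} [NeZero q] {ψ : DirichletCharacter ℂ q} {ρ : ℂ}
    (h0 : 0 < ρ.re) (h1 : ρ.re < 1) (h : LFunction ψ ρ = 0) :
    haveI : NeZero ψ.conductor := ⟨ψ.conductor_ne_zero⟩
    LFunction ψ.primitiveCharacter ρ = 0 := by
  have : NeZero ψ.conductor := ⟨ψ.conductor_ne_zero⟩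
  have hρ : ρ ≠ 1 := by rintro rfl; simp at h1
  rw [← changeLevel_primitiveCharacter ψ, LFunction_changeLevel _ _ (Or.inr hρ)] at h
  refine (mul_eq_zero.1 h).resolve_right (Finset.prod_ne_zero_iff.2 fun p hp ↦ ?_)
  have hp' := (Nat.prime_of_mem_primeFactors hp)
  intro h2
  have h3 : ‖ψ.primitiveCharacter p * (p : ℂ) ^ (-ρ)‖ = 1 := by
    rw [← sub_eq_zero.1 h2, norm_one]
  rw [norm_mul, Complex.norm_natCast_cpow_of_pos hp'.pos, neg_re] at h3
  have h4 : (p : ℝ) ^ (-ρ.re) < 1 :=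
    Real.rpow_lt_one_of_one_lt_of_neg (by exact_mod_cast hp'.one_lt) (by linarith)
  have h5 := ψ.primitiveCharacter.norm_le_one p
  have h6 : 0 ≤ (p : ℝ) ^ (-ρ.re) := by positivity
  nlinarith

/-- The prime sum of the primitive character inducing `ψ`. -/
noncomputable def inducedSum {q : ℕ} (ψ : DirichletCharacter ℂ q) (δ τ : ℝ) : ℝ :=
  primeSum ψ.primitiveCharacter δ τ

lemma log_term_le {f T B D e : ℝ} (hf : 1 ≤ f) (hT : 1 ≤ T) (hB0 : 0 < B) (hB : B ≤ D * T ^ 2)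
    (hD : D ≤ 39.47 * Real.exp (8 * e)) :
    1 / 8 * Real.log ((f / (2 * π)) ^ 2 * B) ≤ 1 / 4 * (Real.log f + Real.log T) + e := by
  have hπ : 39.47 ≤ (2 * π) ^ 2 := by
    have := Real.pi_gt_d4
    nlinarith
  have h1 : (f / (2 * π)) ^ 2 * B ≤ f ^ 2 * T ^ 2 * Real.exp (8 * e) := by
    rw [div_pow, div_mul_eq_mul_div, div_le_iff₀ (by positivity)]
    have h2 : B ≤ T ^ 2 * Real.exp (8 * e) * (2 * π) ^ 2 := by
      calc B ≤ D * T ^ 2 := hB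
        _ ≤ 39.47 * Real.exp (8 * e) * T ^ 2 := by gcongr
        _ ≤ (2 * π) ^ 2 * Real.exp (8 * e) * T ^ 2 := by gcongr
        _ = _ := by ring
    calc f ^ 2 * B ≤ f ^ 2 * (T ^ 2 * Real.exp (8 * e) * (2 * π) ^ 2) := by gcongr
      _ = _ := by ring
  have h2 := Real.log_le_log (by positivity) h1
  have h3 : Real.log (f ^ 2 * T ^ 2 * Real.exp (8 * e)) =
      2 * Real.log f + 2 * Real.log T + 8 * e := by
    rw [Real.log_mul (by positivity) (by positivity), Real.log_mul (by positivity) (by positivity),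
      Real.log_exp, Real.log_pow, Real.log_pow]
    push_cast
    ring
  linarith

lemma inducedSum_le {q : ℕ} [NeZero q] (ψ : DirichletCharacter ℂ q) {δ : ℝ} (hδ : 0 < δ)
    (hδ' : δ ≤ 3 / 2) (τ : ℝ) {T D e : ℝ} (hT : 1 ≤ T)
    (hB : 5 / 2 + τ ^ 2 + (1 + 2 * δ) ^ 2 / 3 ≤ D * T ^ 2) (hD : D ≤ 39.47 * Real.exp (8 * e))
    (Z : Finset ℂ) (hZ : ∀ ρ ∈ Z, 0 < ρ.re ∧ ρ.re < 1 ∧ LFunction ψ ρ = 0) :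
    inducedSum ψ δ τ ≤ 1 / 4 * (Real.log ψ.conductor + Real.log T) + e +
      (if ψ = 1 then δ / (δ ^ 2 + τ ^ 2) else 0) +
      ∑ ρ ∈ Z, (1 / 2 * zeroCost (1 + 2 * δ) (1 + δ - ρ.re) -
        (1 + δ - ρ.re) / ((1 + δ - ρ.re) ^ 2 + (τ - ρ.im) ^ 2)) := by
  have : NeZero ψ.conductor := ⟨ψ.conductor_ne_zero⟩
  have h1 := two_mul_primeSum_le (primitiveCharacter_isPrimitive ψ) hδ hδ' τ Z
    fun ρ hρ ↦ ⟨(hZ ρ hρ).1, (hZ ρ hρ).2.1,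
      LFunction_primitiveCharacter_eq_zero (hZ ρ hρ).1 (hZ ρ hρ).2.1 (hZ ρ hρ).2.2⟩
  have h2 := log_term_le (f := ψ.conductor) (T := T) (by exact_mod_cast NeZero.one_le) hT
    (by positivity) hB hD
  have h3 : ∑ ρ ∈ Z, (zeroCost (1 + 2 * δ) (1 + δ - ρ.re) -
        2 * (1 + δ - ρ.re) / ((1 + δ - ρ.re) ^ 2 + (τ - ρ.im) ^ 2)) =
      2 * ∑ ρ ∈ Z, (1 / 2 * zeroCost (1 + 2 * δ) (1 + δ - ρ.re) -
        (1 + δ - ρ.re) / ((1 + δ - ρ.re) ^ 2 + (τ - ρ.im) ^ 2)) := by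
    rw [Finset.mul_sum]
    exact Finset.sum_congr rfl fun ρ _ ↦ by ring
  have h4 : (if ψ.conductor = 1 then 2 * δ / (δ ^ 2 + τ ^ 2) else 0) =
      2 * (if ψ = 1 then δ / (δ ^ 2 + τ ^ 2) else 0) := by
    by_cases h : ψ = 1
    · rw [if_pos h, if_pos (eq_one_iff_conductor_eq_one.1 h)]; ring
    · rw [if_neg h, if_neg fun h' ↦ h (eq_one_iff_conductor_eq_one.2 h')]; ring
  rw [h3, h4] at h1
  unfold inducedSum
  linarith

lemma log_conductor_le {q : ℕ} [NeZero q] (ψ : DirichletCharacter ℂ q) :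
    Real.log ψ.conductor ≤ Real.log q := by
  have h : ψ.conductor ≤ q := Nat.le_of_dvd (NeZero.pos q) ψ.conductor_dvd_level
  have h0 : 0 < ψ.conductor := Nat.pos_of_ne_zero ψ.conductor_ne_zero
  exact Real.log_le_log (by exact_mod_cast h0) (by exact_mod_cast h)

lemma log_conductor_one {q : ℕ} [NeZero q] :
    Real.log (1 : DirichletCharacter ℂ q).conductor = 0 := by
  rw [conductor_one]; simp

lemma half_zeroCost_le {κ x : ℝ} (hx : 0 ≤ x) (hxκ : x < κ) :
    1 / 2 * zeroCost κ x ≤ x / (κ * (κ - x)) := by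
  have h0 : 0 < κ := by linarith
  have h1 : 0 < κ - x := by linarith
  have h2 : Real.log ((κ + x) / (κ - x)) ≤ (κ + x) / (κ - x) - 1 :=
    Real.log_le_sub_one_of_pos (by positivity)
  have h3 : (κ + x) / (κ - x) - 1 = 2 * x / (κ - x) := by field_simp; ring
  rw [h3] at h2
  unfold zeroCost
  calc 1 / 2 * (Real.log ((κ + x) / (κ - x)) / κ) ≤ 1 / 2 * (2 * x / (κ - x) / κ) := by gcongr
    _ = _ := by field_simp

lemma LFunction_inv_conj_eq_zero {q : ℕ} [NeZero q] {χ : DirichletCharacter ℂ q} {ρ : ℂ}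
    (h1 : ρ.re < 1) (h : LFunction χ ρ = 0) : LFunction χ⁻¹ ((starRingEnd ℂ) ρ) = 0 := by
  have hρ : ρ ≠ 1 := by rintro rfl; simp at h1
  rw [← conj_LFunction χ hρ, h, map_zero]

/-- Exponential lower bound from an integer power of `e`. -/
lemma le_exp_neg_div {y : ℝ} (p r : ℕ) (hr : r ≠ 0) (hy : 0 ≤ y)
    (h : y ^ r * 2.7182818286 ^ p ≤ 1) : y ≤ Real.exp (-(p / r : ℝ)) := by
  have hr' : (r : ℝ) ≠ 0 := by exact_mod_cast hr
  refine le_of_pow_le_pow_left₀ hr (Real.exp_pos _).le ?_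
  have h1 : Real.exp (-(p / r : ℝ)) ^ r = (Real.exp 1 ^ p)⁻¹ := by
    rw [← Real.exp_nat_mul, ← Real.exp_nat_mul, mul_one, ← Real.exp_neg]
    congr 1
    field_simp
  rw [h1, ← one_div, le_div_iff₀ (by positivity)]
  refine le_trans ?_ h
  have := Real.exp_one_lt_d9.le
  gcongr

/-- The coefficients of the cosine polynomial `(cos φ + 3/10)² (cos φ + 9/10)²`. -/
noncomputable def cosCoeff : Fin 5 → ℝ := ![1.4379, 2.448, 1.49, 0.6, 0.125]

lemma sum_cosCoeff_mul_re_nonneg {z : ℂ} (hz : ‖z‖ = 1) :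
    0 ≤ ∑ k : Fin 5, cosCoeff k * (z ^ (k : ℕ)).re := by
  have h1 : z.re ^ 2 + z.im ^ 2 = 1 := by
    have := Complex.sq_norm z
    rw [hz, normSq_apply] at this
    linarith
  have h2 : ∑ k : Fin 5, cosCoeff k * (z ^ (k : ℕ)).re =
      ((z.re + 3 / 10) * (z.re + 9 / 10)) ^ 2 := by
    simp only [Fin.sum_univ_five, cosCoeff]
    simp only [Matrix.cons_val, Fin.val_zero, Fin.val_one, Fin.val_two, pow_zero, pow_one, one_re]
    have h3 : z.im ^ 2 = 1 - z.re ^ 2 := by linear_combination h1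
    have e2 : (z ^ 2).re = 2 * z.re ^ 2 - 1 := by
      rw [pow_two, mul_re]; linear_combination -h3
    have e3 : (z ^ 3).re = 4 * z.re ^ 3 - 3 * z.re := by
      simp only [pow_succ, pow_zero, one_mul, mul_re, mul_im]; linear_combination -3 * z.re * h3
    have e4 : (z ^ 4).re = 8 * z.re ^ 4 - 8 * z.re ^ 2 + 1 := by
      simp only [pow_succ, pow_zero, one_mul, mul_re, mul_im]
      linear_combination (z.im ^ 2 + 1 - 7 * z.re ^ 2) * h3
    change _ + _ + _ + 0.6 * (z ^ 3).re + 0.125 * (z ^ 4).re = _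
    rw [e2, e3, e4]
    ring
  rw [h2]
  positivity

lemma norm_apply_unit {q : ℕ} [NeZero q] (χ : DirichletCharacter ℂ q) (u : (ZMod q)ˣ) : ‖χ u‖ = 1 :=
  χ.unit_norm_eq_one u

lemma sum_shifted_nonneg {q : ℕ} [NeZero q] (χ : DirichletCharacter ℂ q) {δ : ℝ} (hδ : 0 < δ)
    (t : ℝ) {n : ℕ} (r x : Fin n → ℝ) :
    0 ≤ ∑ i, ∑ j, r i * r j * ∑ k : Fin 5, cosCoeff k *
      inducedSum (χ ^ (k : ℕ)) δ (k * t + (x i - x j)) := by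
  have h := sum_mul_primeSum_nonneg (q := q) (ι := (Fin n × Fin n) × Fin 5) Finset.univ
    (fun p ↦ r p.1.1 * r p.1.2 * cosCoeff p.2) (fun p ↦ χ ^ (p.2 : ℕ))
    (fun p ↦ p.2 * t + (x p.1.1 - x p.1.2)) hδ ?_
  · simp only [Fintype.sum_prod_type] at h
    convert h using 4 with i _ j _
    rw [Finset.mul_sum]
    refine Finset.sum_congr rfl fun k _ ↦ ?_
    rw [inducedSum]; ring
  intro u θ
  set z : ℂ := χ u * cexp (-(t * θ : ℝ) * I) with hz
  have hz1 : ‖z‖ = 1 := by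
    rw [hz, norm_mul, norm_apply_unit, ← ofReal_neg, Complex.norm_exp_ofReal_mul_I, mul_one]
  set E : Fin n → ℂ := fun i ↦ cexp (-(x i * θ : ℝ) * I) with hE
  have hterm : ∀ i j (k : Fin 5), (χ ^ (k : ℕ)) u * cexp (-(((k : ℕ) * t + (x i - x j)) * θ : ℝ) * I) =
      z ^ (k : ℕ) * (E i * (starRingEnd ℂ) (E j)) := by
    intro i j k
    rw [hz, mul_pow, MulChar.pow_apply_coe, mul_assoc, hE]
    simp only
    rw [← Complex.exp_conj, ← Complex.exp_nat_mul, ← Complex.exp_add, ← Complex.exp_add]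
    congr 2
    simp only [map_mul, map_neg, conj_ofReal, conj_I]
    push_cast
    ring
  have h2 : ∑ p : (Fin n × Fin n) × Fin 5, r p.1.1 * r p.1.2 * cosCoeff p.2 *
      ((χ ^ (p.2 : ℕ)) u * cexp (-(((p.2 : ℕ) * t + (x p.1.1 - x p.1.2)) * θ : ℝ) * I)).re =
      Complex.normSq (∑ i, r i * E i) * ∑ k : Fin 5, cosCoeff k * (z ^ (k : ℕ)).re := by
    simp only [hterm]
    have h3 : Complex.normSq (∑ i, r i * E i) * ∑ k : Fin 5, cosCoeff k * (z ^ (k : ℕ)).re =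
        (((∑ i, r i * E i) * (starRingEnd ℂ) (∑ i, r i * E i)) *
          ∑ k : Fin 5, cosCoeff k * z ^ (k : ℕ)).re := by
      rw [Complex.mul_conj, Complex.re_ofReal_mul, Complex.re_sum]
      simp
    rw [h3, map_sum, Finset.sum_mul_sum, Finset.sum_mul, Complex.re_sum, Fintype.sum_prod_type,
      Fintype.sum_prod_type]
    refine Finset.sum_congr rfl fun i _ ↦ ?_
    rw [Finset.sum_mul, Complex.re_sum]
    refine Finset.sum_congr rfl fun j _ ↦ ?_
    rw [Finset.mul_sum, Complex.re_sum]
    refine Finset.sum_congr rfl fun k _ ↦ ?_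
    rw [map_mul, conj_ofReal, ← Complex.re_ofReal_mul]
    congr 1
    push_cast
    ring
  rw [h2]
  exact mul_nonneg (normSq_nonneg _) (sum_cosCoeff_mul_re_nonneg hz1)

/-- The weights of the smoothing kernel. -/
noncomputable def kernelWeight : Fin 10 → ℝ := ![2, 3, 4, 4, 5, 5, 4, 4, 3, 2]

lemma kernel_numeric :
    ∑ i : Fin 10, ∑ j : Fin 10, kernelWeight i * kernelWeight j *
      (1 / 4 * 4.663 / 6.397 + (1.4379 * (5 / 7) / ((5 / 7) ^ 2 + (((i : ℕ) - (j : ℕ) : ℝ) * (2 / 3)) ^ 2) -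
        2.448 * (12 / 7) / ((12 / 7) ^ 2 + (((i : ℕ) - (j : ℕ) : ℝ) * (2 / 3)) ^ 2))) < 0 := by
  simp [Fin.sum_univ_succ, kernelWeight]
  norm_num

/-- The smoothed explicit inequality cannot hold if the zero is too close to the line. -/
lemma kernel_contradiction {q : ℕ} [NeZero q] (χ : DirichletCharacter ℂ q) (t : ℝ) {l L : ℝ}
    (hl : 0 < l) (hL : 6.397 * l * L ≤ 1)
    (H : ∀ y : ℝ, |y| ≤ 6 * l → ∑ k : Fin 5, cosCoeff k *
      inducedSum (χ ^ (k : ℕ)) (5 / 7 * l) (k * t + y) ≤ 1 / 4 * 4.663 * L +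
        1.4379 * (5 / 7 * l / ((5 / 7 * l) ^ 2 + y ^ 2)) -
        2.448 * (12 / 7 * l / ((12 / 7 * l) ^ 2 + y ^ 2))) : False := by
  have h0 := sum_shifted_nonneg χ (δ := 5 / 7 * l) (by positivity) t kernelWeight
    (fun i ↦ (i : ℕ) * (2 / 3 * l))
  have hw : ∀ i, 0 ≤ kernelWeight i := by
    intro i; fin_cases i <;> norm_num [kernelWeight]
  have h1 : ∑ i, ∑ j, kernelWeight i * kernelWeight j * ∑ k : Fin 5, cosCoeff k *
      inducedSum (χ ^ (k : ℕ)) (5 / 7 * l) (k * t + ((i : ℕ) * (2 / 3 * l) - (j : ℕ) * (2 / 3 * l))) ≤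
      ∑ i : Fin 10, ∑ j : Fin 10, l⁻¹ * (kernelWeight i * kernelWeight j *
      (1 / 4 * 4.663 / 6.397 + (1.4379 * (5 / 7) / ((5 / 7) ^ 2 + (((i : ℕ) - (j : ℕ) : ℝ) * (2 / 3)) ^ 2) -
        2.448 * (12 / 7) / ((12 / 7) ^ 2 + (((i : ℕ) - (j : ℕ) : ℝ) * (2 / 3)) ^ 2)))) := by
    refine Finset.sum_le_sum fun i _ ↦ Finset.sum_le_sum fun j _ ↦ ?_
    rw [mul_left_comm l⁻¹]
    refine mul_le_mul_of_nonneg_left ?_ (mul_nonneg (hw i) (hw j))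
    have hi : ((i : ℕ) : ℝ) ≤ 9 := by exact_mod_cast Nat.le_of_lt_succ i.2
    have hj : ((j : ℕ) : ℝ) ≤ 9 := by exact_mod_cast Nat.le_of_lt_succ j.2
    have hi0 : (0 : ℝ) ≤ ((i : ℕ) : ℝ) := Nat.cast_nonneg _
    have hj0 : (0 : ℝ) ≤ ((j : ℕ) : ℝ) := Nat.cast_nonneg _
    have hy : (i : ℕ) * (2 / 3 * l) - (j : ℕ) * (2 / 3 * l) =
      (((i : ℕ) - (j : ℕ) : ℝ) * (2 / 3)) * l := by ring
    refine (H _ ?_).trans ?_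
    · rw [hy, abs_mul, abs_of_pos hl]
      refine mul_le_mul_of_nonneg_right ?_ hl.le
      rw [abs_le]; constructor <;> linarith
    · rw [hy]
      generalize (((i : ℕ) - (j : ℕ) : ℝ) * (2 / 3)) = m
      have e1 : 5 / 7 * l / ((5 / 7 * l) ^ 2 + (m * l) ^ 2) = l⁻¹ * ((5 / 7) / ((5 / 7) ^ 2 + m ^ 2)) := by
        have : (5 / 7 : ℝ) ^ 2 + m ^ 2 ≠ 0 := by positivity
        field_simp
      have e2 : 12 / 7 * l / ((12 / 7 * l) ^ 2 + (m * l) ^ 2) =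
          l⁻¹ * ((12 / 7) / ((12 / 7) ^ 2 + m ^ 2)) := by
        have : (12 / 7 : ℝ) ^ 2 + m ^ 2 ≠ 0 := by positivity
        field_simp
      have e3 : L ≤ l⁻¹ * (1 / 6.397) := by
        rw [inv_mul_eq_div, le_div_iff₀ hl, le_div_iff₀ (by norm_num)]
        linarith
      rw [e1, e2]
      have e4 : l⁻¹ * (1 / 4 * 4.663 / 6.397 + (1.4379 * (5 / 7) / ((5 / 7) ^ 2 + m ^ 2) -
        2.448 * (12 / 7) / ((12 / 7) ^ 2 + m ^ 2))) = 1 / 4 * 4.663 * (l⁻¹ * (1 / 6.397)) +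
        1.4379 * (l⁻¹ * ((5 / 7) / ((5 / 7) ^ 2 + m ^ 2))) -
        2.448 * (l⁻¹ * ((12 / 7) / ((12 / 7) ^ 2 + m ^ 2))) := by ring
      rw [e4]
      linarith
  have h2 := h0.trans h1
  simp only [← Finset.mul_sum] at h2
  have h3 := mul_neg_of_pos_of_neg (inv_pos.2 hl) kernel_numeric
  linarith

/-- The contribution of the pole of `ζ` in the kernel argument. -/
noncomputable def poleTerm (l y : ℝ) : ℝ := 5 / 7 * l / ((5 / 7 * l) ^ 2 + y ^ 2)

/-- The contribution of a zero at distance `l` from the line in the kernel argument. -/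
noncomputable def zeroTerm (l y : ℝ) : ℝ := 12 / 7 * l / ((12 / 7 * l) ^ 2 + y ^ 2)

lemma poleTerm_le_zeroTerm {l : ℝ} (hl : 0 < l) (y : ℝ) :
    poleTerm l y ≤ 12 / 5 * zeroTerm l y := by
  unfold poleTerm zeroTerm
  rw [← mul_div_assoc, div_le_div_iff₀ (by positivity) (by positivity)]
  nlinarith [mul_nonneg hl.le (sq_nonneg y)]

lemma zeroTerm_nonneg {l : ℝ} (hl : 0 < l) (y : ℝ) : 0 ≤ zeroTerm l y := by
  unfold zeroTerm; positivity

lemma poleTerm_le {l y b c : ℝ} (hl : 0 < l) (hb : 0 < b) (hy : b ≤ |y|)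
    (h : 5 / 7 * l ≤ c * ((5 / 7 * l) ^ 2 + b ^ 2)) : poleTerm l y ≤ c := by
  unfold poleTerm
  rw [div_le_iff₀ (by positivity)]
  have hc : 0 ≤ c := by
    by_contra hc
    have : 0 < (5 / 7 * l) ^ 2 + b ^ 2 := by positivity
    nlinarith
  have h1 : b ^ 2 ≤ y ^ 2 := by rw [← sq_abs y]; gcongr
  exact h.trans (by gcongr)

lemma kernel_contradiction' {q : ℕ} [NeZero q] (χ : DirichletCharacter ℂ q) (t : ℝ) {l L : ℝ}
    (hl : 0 < l) (hL : 6.397 * l * L ≤ 1)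
    (H : ∀ y : ℝ, |y| ≤ 6 * l →
      1.4379 * inducedSum (1 : DirichletCharacter ℂ q) (5 / 7 * l) y +
      2.448 * inducedSum χ (5 / 7 * l) (t + y) + 1.49 * inducedSum (χ ^ 2) (5 / 7 * l) (2 * t + y) +
      0.6 * inducedSum (χ ^ 3) (5 / 7 * l) (3 * t + y) +
      0.125 * inducedSum (χ ^ 4) (5 / 7 * l) (4 * t + y) ≤ 1 / 4 * 4.663 * L +
        1.4379 * poleTerm l y - 2.448 * zeroTerm l y) : False := by
  refine kernel_contradiction χ t hl hL fun y hy ↦ ?_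
  have h := H y hy
  have e : ∑ k : Fin 5, cosCoeff k * inducedSum (χ ^ (k : ℕ)) (5 / 7 * l) (k * t + y) =
      1.4379 * inducedSum (1 : DirichletCharacter ℂ q) (5 / 7 * l) y +
      2.448 * inducedSum χ (5 / 7 * l) (t + y) + 1.49 * inducedSum (χ ^ 2) (5 / 7 * l) (2 * t + y) +
      0.6 * inducedSum (χ ^ 3) (5 / 7 * l) (3 * t + y) +
      0.125 * inducedSum (χ ^ 4) (5 / 7 * l) (4 * t + y) := by
    rw [Fin.sum_univ_five]
    simp [cosCoeff]
  rw [e]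
  exact h

lemma exp_const₀ : (3.73 : ℝ) ≤ 39.47 * Real.exp (8 * (-(7 / 24))) := by
  have := le_exp_neg_div (y := 0.0946) 7 3 (by norm_num) (by norm_num) (by norm_num)
  rw [show (8 * (-(7 / 24)) : ℝ) = -((7 : ℕ) / (3 : ℕ) : ℝ) by norm_num]
  linarith

lemma exp_const₁ : (6.45 : ℝ) ≤ 39.47 * Real.exp (8 * (-(7 / 32))) := by
  have := le_exp_neg_div (y := 0.1635) 7 4 (by norm_num) (by norm_num) (by norm_num)
  rw [show (8 * (-(7 / 32)) : ℝ) = -((7 : ℕ) / (4 : ℕ) : ℝ) by norm_num]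
  linarith

lemma exp_const₂ : (11.17 : ℝ) ≤ 39.47 * Real.exp (8 * (-(3 / 20))) := by
  have := le_exp_neg_div (y := 0.284) 6 5 (by norm_num) (by norm_num) (by norm_num)
  rw [show (8 * (-(3 / 20)) : ℝ) = -((6 : ℕ) / (5 : ℕ) : ℝ) by norm_num]
  linarith

lemma exp_const₃ : (17.89 : ℝ) ≤ 39.47 * Real.exp (8 * (-(3 / 32))) := by
  have := le_exp_neg_div (y := 0.46) 3 4 (by norm_num) (by norm_num) (by norm_num)
  rw [show (8 * (-(3 / 32)) : ℝ) = -((3 : ℕ) / (4 : ℕ) : ℝ) by norm_num]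
  linarith

lemma exp_const₄ : (26.61 : ℝ) ≤ 39.47 * Real.exp (8 * (-(1 / 24))) := by
  have := le_exp_neg_div (y := 0.69) 1 3 (by norm_num) (by norm_num) (by norm_num)
  rw [show (8 * (-(1 / 24)) : ℝ) = -((1 : ℕ) / (3 : ℕ) : ℝ) by norm_num]
  linarith

section Kernel

variable {q : ℕ} [NeZero q] (ψ : DirichletCharacter ℂ q) {l t y k D e : ℝ}

lemma kernel_height_le (hl : 0 < l) (hl' : l ≤ 0.1428) (hk : 0 ≤ k) (hy : |y| ≤ 6 * l)
    (hD : 2.9833 + (k + 0.86) ^ 2 ≤ D) :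
    5 / 2 + (k * t + y) ^ 2 + (1 + 2 * (5 / 7 * l)) ^ 2 / 3 ≤ D * (max 1 |t|) ^ 2 := by
  have hT : 1 ≤ max 1 |t| := le_max_left _ _
  have ht : |t| ≤ max 1 |t| := le_max_right _ _
  generalize max 1 |t| = T at *
  have h1 : |k * t + y| ≤ (k + 0.86) * T := by
    calc |k * t + y| ≤ |k * t| + |y| := abs_add_le _ _
      _ = k * |t| + |y| := by rw [abs_mul, abs_of_nonneg hk]
      _ ≤ k * T + 0.86 * T := by gcongr; linarith
      _ = _ := by ring
  have h2 : (k * t + y) ^ 2 ≤ (k + 0.86) ^ 2 * T ^ 2 := by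
    rw [← mul_pow, ← sq_abs]; gcongr
  have h3 : (1 + 2 * (5 / 7 * l)) ^ 2 ≤ 1.204 ^ 2 := by gcongr; linarith
  have h4 : 1 ≤ T ^ 2 := one_le_pow₀ hT
  nlinarith

lemma kernel_inducedSum_le (hl : 0 < l) (hl' : l ≤ 0.1428) (hk : 0 ≤ k) (hy : |y| ≤ 6 * l)
    (hD : 2.9833 + (k + 0.86) ^ 2 ≤ D) (he : D ≤ 39.47 * Real.exp (8 * e)) :
    inducedSum ψ (5 / 7 * l) (k * t + y) ≤
      1 / 4 * (Real.log ψ.conductor + Real.log (max 1 |t|)) + e +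
        (if ψ = 1 then poleTerm l (k * t + y) else 0) := by
  have := inducedSum_le ψ (δ := 5 / 7 * l) (by positivity) (by linarith) (k * t + y)
    (T := max 1 |t|) (le_max_left _ _) (kernel_height_le hl hl' hk hy hD) he ∅ (by simp)
  simpa [poleTerm] using this

lemma kernel_inducedSum_le_of_zero (hl : 0 < l) (hl' : l ≤ 0.1428) (hk : 0 ≤ k) (hy : |y| ≤ 6 * l)
    (hD : 2.9833 + (k + 0.86) ^ 2 ≤ D) (he : D ≤ 39.47 * Real.exp (8 * e)) {ρ : ℂ}
    (hρ : ρ.re = 1 - l) (h0 : LFunction ψ ρ = 0) :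
    inducedSum ψ (5 / 7 * l) (k * t + y) ≤
      1 / 4 * (Real.log ψ.conductor + Real.log (max 1 |t|)) + e +
        (if ψ = 1 then poleTerm l (k * t + y) else 0) + 0.245 -
        zeroTerm l (k * t + y - ρ.im) := by
  have h := inducedSum_le ψ (δ := 5 / 7 * l) (by positivity) (by linarith) (k * t + y)
    (T := max 1 |t|) (le_max_left _ _) (kernel_height_le hl hl' hk hy hD) he {ρ}
    (by simp only [Finset.mem_singleton, forall_eq]
        exact ⟨by rw [hρ]; linarith, by rw [hρ]; linarith, h0⟩)
  rw [Finset.sum_singleton, hρ, show 1 + 5 / 7 * l - (1 - l) = 12 / 7 * l by ring] at h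
  have h1 : 1 / 2 * zeroCost (1 + 2 * (5 / 7 * l)) (12 / 7 * l) ≤ 0.245 := by
    refine (half_zeroCost_le (by positivity) (by linarith)).trans ?_
    rw [div_le_iff₀ (mul_pos (by linarith) (by linarith))]
    nlinarith
  have h2 : 5 / 7 * l / ((5 / 7 * l) ^ 2 + (k * t + y) ^ 2) = poleTerm l (k * t + y) := rfl
  have h3 : 12 / 7 * l / ((12 / 7 * l) ^ 2 + (k * t + y - ρ.im) ^ 2) =
    zeroTerm l (k * t + y - ρ.im) := rfl
  rw [h2, h3] at h
  linarith

lemma kernel_inducedSum_one_le (hl : 0 < l) (hl' : l ≤ 0.1428) (hy : |y| ≤ 6 * l) :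
    inducedSum (1 : DirichletCharacter ℂ q) (5 / 7 * l) y ≤ -(7 / 24) + poleTerm l y := by
  have h := kernel_inducedSum_le (1 : DirichletCharacter ℂ q) (t := 0) (k := 0) (y := y) hl hl' le_rfl hy
    (by norm_num) exp_const₀
  rw [log_conductor_one] at h
  simpa using h

end Kernel

lemma distance_le {q : ℕ} (hq : 3 ≤ q) {l : ℝ} (hl : 0 < l) {t : ℝ}
    (hL : 6.397 * l * (Real.log q + Real.log (max 1 |t|)) ≤ 1) : l ≤ 0.1428 := by
  have h1 : Real.log 3 ≤ Real.log q := Real.log_le_log (by norm_num) (by exact_mod_cast hq)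
  have h2 : 0 ≤ Real.log (max 1 |t|) := Real.log_nonneg (le_max_left _ _)
  have h3 := Real.log_three_gt_d9
  by_contra h
  push Not at h
  nlinarith

section Cases

variable {q : ℕ} [NeZero q] {χ : DirichletCharacter ℂ q} {ρ : ℂ} {l : ℝ}

/-- No zeros close to the line for characters of order at least three. -/
lemma false_of_zero_of_sq_ne_one (hq : 3 ≤ q) (hl : 0 < l) (hρ : ρ.re = 1 - l)
    (hL : 6.397 * l * (Real.log q + Real.log (max 1 |ρ.im|)) ≤ 1)
    (h0 : LFunction χ ρ = 0) (h2 : χ ^ 2 ≠ 1) : False := by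
  have hl' := distance_le hq hl hL
  have h1 : χ ≠ 1 := fun h ↦ h2 (by rw [h, one_pow])
  have hc := LFunction_inv_conj_eq_zero (by linarith) h0
  refine kernel_contradiction' χ ρ.im hl hL fun y hy ↦ ?_
  have b0 := kernel_inducedSum_one_le (q := q) hl hl' hy
  have b1 := kernel_inducedSum_le_of_zero χ (t := ρ.im) (k := 1) hl hl' (by norm_num) hy
    (by norm_num) exp_const₁ hρ h0
  rw [if_neg h1, one_mul, add_sub_cancel_left] at b1
  have c1 := log_conductor_le χ
  have c2 := log_conductor_le (χ ^ 2)
  have c3 := log_conductor_le (χ ^ 3)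
  have c4 := log_conductor_le (χ ^ 4)
  by_cases h3 : χ ^ 3 = 1
  · have e2 : χ ^ 2 = χ⁻¹ := by rw [eq_inv_iff_mul_eq_one, ← pow_succ, h3]
    have e4 : χ ^ 4 = χ := by rw [pow_succ, h3, one_mul]
    have b2 := kernel_inducedSum_le_of_zero (χ ^ 2) (t := ρ.im) (k := 2) hl hl' (by norm_num) hy
      (by norm_num) exp_const₂ (ρ := (starRingEnd ℂ) ρ) (by rw [conj_re, hρ]) (by rw [e2]; exact hc)
    have b3 := kernel_inducedSum_le (χ ^ 3) (t := ρ.im) (k := 3) hl hl' (by norm_num) hy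
      (by norm_num) exp_const₃
    have b4 := kernel_inducedSum_le_of_zero (χ ^ 4) (t := ρ.im) (k := 4) hl hl' (by norm_num) hy
      (by norm_num) exp_const₄ hρ (by rw [e4]; exact h0)
    rw [if_neg h2, conj_im, show 2 * ρ.im + y - -ρ.im = 3 * ρ.im + y by ring] at b2
    rw [if_pos h3] at b3
    rw [if_neg (by rw [e4]; exact h1), show 4 * ρ.im + y - ρ.im = 3 * ρ.im + y by ring] at b4
    have hp := poleTerm_le_zeroTerm hl (3 * ρ.im + y)
    have hz := zeroTerm_nonneg hl (3 * ρ.im + y)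
    linarith
  have b2 := kernel_inducedSum_le (χ ^ 2) (t := ρ.im) (k := 2) hl hl' (by norm_num) hy
      (by norm_num) exp_const₂
  rw [if_neg h2] at b2
  by_cases h4 : χ ^ 4 = 1
  · have e3 : χ ^ 3 = χ⁻¹ := by rw [eq_inv_iff_mul_eq_one, ← pow_succ, h4]
    have b3 := kernel_inducedSum_le_of_zero (χ ^ 3) (t := ρ.im) (k := 3) hl hl' (by norm_num) hy
      (by norm_num) exp_const₃ (ρ := (starRingEnd ℂ) ρ) (by rw [conj_re, hρ]) (by rw [e3]; exact hc)
    have b4 := kernel_inducedSum_le (χ ^ 4) (t := ρ.im) (k := 4) hl hl' (by norm_num) hy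
      (by norm_num) exp_const₄
    rw [if_neg h3, conj_im, show 3 * ρ.im + y - -ρ.im = 4 * ρ.im + y by ring] at b3
    rw [if_pos h4] at b4
    have hp := poleTerm_le_zeroTerm hl (4 * ρ.im + y)
    have hz := zeroTerm_nonneg hl (4 * ρ.im + y)
    linarith
  · have b3 := kernel_inducedSum_le (χ ^ 3) (t := ρ.im) (k := 3) hl hl' (by norm_num) hy
      (by norm_num) exp_const₃
    have b4 := kernel_inducedSum_le (χ ^ 4) (t := ρ.im) (k := 4) hl hl' (by norm_num) hy
      (by norm_num) exp_const₄
    rw [if_neg h3] at b3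
    rw [if_neg h4] at b4
    linarith

/-- No zeros of a quadratic character close to the line at large height. -/
lemma false_of_zero_of_quadratic_high (hq : 3 ≤ q) (hl : 0 < l) (hρ : ρ.re = 1 - l)
    (hL : 6.397 * l * (Real.log q + Real.log (max 1 |ρ.im|)) ≤ 1)
    (h0 : LFunction χ ρ = 0) (h1 : χ ≠ 1) (h2 : χ ^ 2 = 1)
    (ht : 0.8 ≤ |ρ.im| * Real.log q) : False := by
  have hl' := distance_le hq hl hL
  have hM : 1.0986 ≤ Real.log q := by
    have h1 : Real.log 3 ≤ Real.log q := Real.log_le_log (by norm_num) (by exact_mod_cast hq)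
    have h3 := Real.log_three_gt_d9
    linarith
  have e3 : χ ^ 3 = χ := by rw [pow_succ, h2, one_mul]
  have e4 : χ ^ 4 = 1 := by rw [show 4 = 2 * 2 by norm_num, pow_mul, h2, one_pow]
  refine kernel_contradiction' χ ρ.im hl hL fun y hy ↦ ?_
  have b0 := kernel_inducedSum_one_le (q := q) hl hl' hy
  have b1 := kernel_inducedSum_le_of_zero χ (t := ρ.im) (k := 1) hl hl' (by norm_num) hy
    (by norm_num) exp_const₁ hρ h0
  have b2 := kernel_inducedSum_le (1 : DirichletCharacter ℂ q) (t := ρ.im) (k := 2) hl hl'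
    (by norm_num) hy (by norm_num) exp_const₂
  have b3 := kernel_inducedSum_le χ (t := ρ.im) (k := 3) hl hl' (by norm_num) hy
    (by norm_num) exp_const₃
  have b4 := kernel_inducedSum_le (1 : DirichletCharacter ℂ q) (t := ρ.im) (k := 4) hl hl'
    (by norm_num) hy (by norm_num) exp_const₄
  rw [if_neg h1, one_mul, add_sub_cancel_left] at b1
  rw [if_pos rfl, log_conductor_one] at b2 b4
  rw [if_neg h1] at b3
  rw [h2, e3, e4]
  have c1 := log_conductor_le χ
  have d2 : 2 * |ρ.im| - |y| ≤ |2 * ρ.im + y| := by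
    have := abs_sub_abs_le_abs_sub (2 * ρ.im) (-y)
    rwa [abs_neg, abs_mul, abs_two, sub_neg_eq_add] at this
  have d4 : 4 * |ρ.im| - |y| ≤ |4 * ρ.im + y| := by
    have := abs_sub_abs_le_abs_sub (4 * ρ.im) (-y)
    rwa [abs_neg, abs_mul, abs_of_pos (by norm_num : (0 : ℝ) < 4), sub_neg_eq_add] at this
  rcases le_or_gt 1 |ρ.im| with h | h
  · have p2 := poleTerm_le (y := 2 * ρ.im + y) (b := 1.14) (c := 0.08) hl (by norm_num)
      (by linarith) (by nlinarith)
    have p4 := poleTerm_le (y := 4 * ρ.im + y) (b := 1.14) (c := 0.08) hl (by norm_num)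
      (by linarith) (by nlinarith)
    linarith
  · rw [max_eq_left h.le] at *
    rw [Real.log_one] at *
    generalize Real.log q = M at *
    have hM0 : 0 < M := by linarith
    have p2 := poleTerm_le (y := 2 * ρ.im + y) (b := 0.662 / M) (c := 0.26 * M) hl (by positivity)
      (by rw [div_le_iff₀ hM0]; nlinarith) (by
        have : (0.662 / M) ^ 2 * M = 0.438244 / M := by field_simp; norm_num
        have h5 : 5 / 7 * l ≤ 0.26 * (0.438244 / M) := by
          rw [← mul_div_assoc, le_div_iff₀ hM0]; linarith
        have h6 : 0 ≤ M * (5 / 7 * l) ^ 2 := by positivity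
        linarith)
    have p4 := poleTerm_le (y := 4 * ρ.im + y) (b := 2.26 / M) (c := 0.022 * M) hl (by positivity)
      (by rw [div_le_iff₀ hM0]; nlinarith) (by
        have : (2.26 / M) ^ 2 * M = 5.1076 / M := by field_simp; norm_num
        have h5 : 5 / 7 * l ≤ 0.022 * (5.1076 / M) := by
          rw [← mul_div_assoc, le_div_iff₀ hM0]; linarith
        have h6 : 0 ≤ M * (5 / 7 * l) ^ 2 := by positivity
        linarith)
    linarith

/-- No zeros of the principal `L`-function close to the line at large height. -/
lemma false_of_zero_of_principal_high (hq : 3 ≤ q) (hl : 0 < l) (hρ : ρ.re = 1 - l)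
    (hL : 6.397 * l * (Real.log q + Real.log (max 1 |ρ.im|)) ≤ 1)
    (h0 : LFunction (1 : DirichletCharacter ℂ q) ρ = 0) (ht : 4 / 3 ≤ |ρ.im|) : False := by
  have hl' := distance_le hq hl hL
  have hM : 1.386 ≤ Real.log q + Real.log (max 1 |ρ.im|) := by
    have h1 : Real.log 3 ≤ Real.log q := Real.log_le_log (by norm_num) (by exact_mod_cast hq)
    have h2 : Real.log (4 / 3) ≤ Real.log (max 1 |ρ.im|) :=
      Real.log_le_log (by norm_num) (ht.trans (le_max_right _ _))
    have h3 := Real.log_two_gt_d9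
    have h4 : Real.log 3 + Real.log (4 / 3) = 2 * Real.log 2 := by
      rw [← Real.log_mul (by norm_num) (by norm_num), show (3 * (4 / 3) : ℝ) = 2 ^ 2 by norm_num,
        Real.log_pow]
      norm_num
    linarith
  have hl2 : l ≤ 0.1128 := by nlinarith
  have hM0 : 0 ≤ Real.log q := Real.log_natCast_nonneg q
  refine kernel_contradiction' (1 : DirichletCharacter ℂ q) ρ.im hl hL fun y hy ↦ ?_
  have b0 := kernel_inducedSum_one_le (q := q) hl hl' hy
  have b1 := kernel_inducedSum_le_of_zero (1 : DirichletCharacter ℂ q) (t := ρ.im) (k := 1) hl hl'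
    (by norm_num) hy (by norm_num) exp_const₁ hρ h0
  have b2 := kernel_inducedSum_le (1 : DirichletCharacter ℂ q) (t := ρ.im) (k := 2) hl hl'
    (by norm_num) hy (by norm_num) exp_const₂
  have b3 := kernel_inducedSum_le (1 : DirichletCharacter ℂ q) (t := ρ.im) (k := 3) hl hl'
    (by norm_num) hy (by norm_num) exp_const₃
  have b4 := kernel_inducedSum_le (1 : DirichletCharacter ℂ q) (t := ρ.im) (k := 4) hl hl'
    (by norm_num) hy (by norm_num) exp_const₄
  rw [if_pos rfl, log_conductor_one] at b1 b2 b3 b4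
  rw [one_mul, add_sub_cancel_left] at b1
  simp only [one_pow]
  have d : ∀ k : ℝ, 0 ≤ k → k * (4 / 3) - 6 * l ≤ |k * ρ.im + y| := fun k hk ↦ by
    have := abs_sub_abs_le_abs_sub (k * ρ.im) (-y)
    rw [abs_neg, abs_mul, abs_of_nonneg hk, sub_neg_eq_add] at this
    have := mul_le_mul_of_nonneg_left ht hk
    linarith
  have d1 := d 1 (by norm_num)
  have d2 := d 2 (by norm_num)
  have d3 := d 3 (by norm_num)
  have d4 := d 4 (by norm_num)
  rw [one_mul, one_mul] at d1
  have p1 := poleTerm_le (y := ρ.im + y) (b := 0.656) (c := 0.188) hl (by norm_num)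
      (by linarith) (by nlinarith)
  have p2 := poleTerm_le (y := 2 * ρ.im + y) (b := 1.98) (c := 0.021) hl (by norm_num)
      (by linarith) (by nlinarith)
  have p3 := poleTerm_le (y := 3 * ρ.im + y) (b := 1.98) (c := 0.021) hl (by norm_num)
      (by linarith) (by nlinarith)
  have p4 := poleTerm_le (y := 4 * ρ.im + y) (b := 1.98) (c := 0.021) hl (by norm_num)
      (by linarith) (by nlinarith)
  linarith

end Cases

lemma sum_inducedSum_nonneg {q : ℕ} [NeZero q] {n : ℕ} (ψ : Fin n → DirichletCharacter ℂ q)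
    {δ : ℝ} (hδ : 0 < δ) (h : ∀ u : (ZMod q)ˣ, 0 ≤ ∑ i, (ψ i u).re) :
    0 ≤ ∑ i, inducedSum (ψ i) δ 0 := by
  have := sum_mul_primeSum_nonneg Finset.univ (fun _ ↦ 1) ψ (fun _ ↦ 0) hδ
    (fun u θ ↦ by simpa using h u)
  simpa [inducedSum] using this

/-- At height zero, the induced sum of a character with given zeros. -/
lemma inducedSum_zero_le {q : ℕ} [NeZero q] (ψ : DirichletCharacter ℂ q) {δ D e : ℝ} (hδ : 0 < δ)
    (hδ' : δ ≤ 3 / 2) (hB : 5 / 2 + (1 + 2 * δ) ^ 2 / 3 ≤ D) (hD : D ≤ 39.47 * Real.exp (8 * e))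
    (Z : Finset ℂ) (hZ : ∀ ρ ∈ Z, 0 < ρ.re ∧ ρ.re < 1 ∧ LFunction ψ ρ = 0) :
    inducedSum ψ δ 0 ≤ 1 / 4 * Real.log ψ.conductor + e + (if ψ = 1 then 1 / δ else 0) +
      ∑ ρ ∈ Z, (1 / 2 * zeroCost (1 + 2 * δ) (1 + δ - ρ.re) -
        (1 + δ - ρ.re) / ((1 + δ - ρ.re) ^ 2 + ρ.im ^ 2)) := by
  have h := inducedSum_le ψ hδ hδ' 0 (T := 1) le_rfl (by simpa using hB) hD Z hZ
  have h1 : δ / (δ ^ 2 + 0 ^ 2) = 1 / δ := by field_simp; simp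
  simpa only [h1, zero_sub, neg_sq, Real.log_one, add_zero] using h

lemma exp_const_low : (7.84 : ℝ) ≤ 39.47 * Real.exp (8 * (-(1 / 5))) := by
  have := le_exp_neg_div (y := 0.2) 8 5 (by norm_num) (by norm_num) (by norm_num)
  rw [show (8 * (-(1 / 5)) : ℝ) = -((8 : ℕ) / (5 : ℕ) : ℝ) by norm_num]
  linarith

lemma exp_const_real : (3.5 : ℝ) ≤ 39.47 * Real.exp (8 * (-(3 / 10))) := by
  have := le_exp_neg_div (y := 0.09) 12 5 (by norm_num) (by norm_num) (by norm_num)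
  rw [show (8 * (-(3 / 10)) : ℝ) = -((12 : ℕ) / (5 : ℕ) : ℝ) by norm_num]
  linarith

lemma div_sq_add_sq_ge {x c g y : ℝ} (hx : 0 < x) (hg : |y| ≤ g) (h : c * (x ^ 2 + g ^ 2) ≤ x)
    (hc : 0 ≤ c) : c ≤ x / (x ^ 2 + y ^ 2) := by
  rw [le_div_iff₀ (by positivity)]
  have h1 : y ^ 2 ≤ g ^ 2 := by rw [← sq_abs y]; gcongr
  exact le_trans (by gcongr) h

/-- No zeros of the principal `L`-function close to the line at small height. -/
lemma false_of_zero_of_principal_low {q : ℕ} [NeZero q] {ρ : ℂ} {l : ℝ} (hl : 0 < l)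
    (hl' : l ≤ 0.1428) (hρ : ρ.re = 1 - l)
    (h0 : LFunction (1 : DirichletCharacter ℂ q) ρ = 0) (ht : |ρ.im| ≤ 4 / 3) : False := by
  classical
  have hpos : 0 ≤ inducedSum (1 : DirichletCharacter ℂ q) (3 / 2) 0 := by
    have := sum_inducedSum_nonneg (n := 1) (fun _ ↦ (1 : DirichletCharacter ℂ q))
      (δ := 3 / 2) (by norm_num) (fun u ↦ by simp [MulChar.one_apply_coe])
    simpa using this
  have hc := LFunction_inv_conj_eq_zero (by linarith) h0
  rw [inv_one] at hc
  have hZ : ∀ r ∈ ({ρ, (starRingEnd ℂ) ρ} : Finset ℂ), 0 < r.re ∧ r.re < 1 ∧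
      LFunction (1 : DirichletCharacter ℂ q) r = 0 := by
    intro r hr
    rw [Finset.mem_insert, Finset.mem_singleton] at hr
    rcases hr with rfl | rfl
    · exact ⟨by linarith, by linarith, h0⟩
    · rw [conj_re]; exact ⟨by linarith, by linarith, hc⟩
  have h := inducedSum_zero_le (1 : DirichletCharacter ℂ q) (δ := 3 / 2) (by norm_num) le_rfl
    (by norm_num) exp_const_low _ hZ
  rw [log_conductor_one, if_pos rfl] at h
  have hcost : 1 / 2 * zeroCost (1 + 2 * (3 / 2)) (1 + 3 / 2 - (1 - l)) ≤ 1 / 8 := by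
    have : Real.log ((1 + 2 * (3 / 2) + (1 + 3 / 2 - (1 - l))) /
        (1 + 2 * (3 / 2) - (1 + 3 / 2 - (1 - l)))) ≤ 1 := by
      rw [Real.log_le_iff_le_exp (by apply div_pos <;> linarith)]
      refine le_trans ?_ Real.exp_one_gt_d9.le
      rw [div_le_iff₀ (by linarith)]
      linarith
    unfold zeroCost
    norm_num at this ⊢
    linarith
  by_cases him : ρ.im = 0
  · have e1 : (starRingEnd ℂ) ρ = ρ := conj_eq_iff_im.2 him
    rw [e1, Finset.pair_eq_singleton, Finset.sum_singleton, hρ] at h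
    have := div_sq_add_sq_ge (x := 1 + 3 / 2 - (1 - l)) (c := 0.608) (g := 0) (y := ρ.im)
      (by linarith) (by rw [him]; simp) (by nlinarith) (by norm_num)
    linarith
  · have e1 : ρ ≠ (starRingEnd ℂ) ρ := fun h ↦ him (conj_eq_iff_im.1 h.symm)
    rw [Finset.sum_pair e1, conj_re, conj_im, hρ, neg_sq] at h
    have := div_sq_add_sq_ge (x := 1 + 3 / 2 - (1 - l)) (c := 0.366) (g := 4 / 3) (y := ρ.im)
      (by linarith) ht (by nlinarith) (by norm_num)
    linarith

/-- The net contribution of one zero in the two-zeros argument. -/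
lemma zero_contribution_lt {M l y : ℝ} (hM : 1.0986 ≤ M) (hl : 0 < l) (hL : 6.397 * l * M ≤ 1)
    (hy : |y| * M ≤ 0.8) :
    1 / 2 * zeroCost (1 + 2 * min (3 / 2) (2 / M)) (1 + min (3 / 2) (2 / M) - (1 - l)) -
      (1 + min (3 / 2) (2 / M) - (1 - l)) / ((1 + min (3 / 2) (2 / M) - (1 - l)) ^ 2 + y ^ 2) <
      1 / 5 - 1 / (2 * min (3 / 2) (2 / M)) - M / 8 := by
  have hM0 : 0 < M := by linarith
  have hl' : l ≤ 0.1428 := by nlinarith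
  rcases le_total M (4 / 3) with h | h
  · rw [min_eq_left (by rw [le_div_iff₀ hM0]; linarith)]
    have h1 := half_zeroCost_le (κ := 1 + 2 * (3 / 2)) (x := 1 + 3 / 2 - (1 - l))
      (by linarith) (by linarith)
    have h2 : (1 + 3 / 2 - (1 - l)) / ((1 + 2 * (3 / 2)) * ((1 + 2 * (3 / 2)) -
        (1 + 3 / 2 - (1 - l)))) ≤ 0.175 := by
      rw [div_le_iff₀ (mul_pos (by norm_num) (by linarith))]; linarith
    have h3 := div_sq_add_sq_ge (x := 1 + 3 / 2 - (1 - l)) (c := 0.505) (g := 0.7283) (y := y)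
      (by linarith) (by nlinarith [abs_nonneg y]) (by nlinarith) (by norm_num)
    norm_num at *
    linarith
  · rw [min_eq_right (by rw [div_le_iff₀ hM0]; linarith)]
    obtain ⟨X, hX⟩ : ∃ X, X = 2 + l * M := ⟨_, rfl⟩
    have hX1 : 2 ≤ X := by rw [hX]; nlinarith
    have hX2 : X ≤ 2.1564 := by rw [hX]; linarith
    have e1 : 1 + 2 / M - (1 - l) = X / M := by rw [hX]; field_simp; ring
    have e2 : 1 + 2 * (2 / M) = (M + 4) / M := by field_simp; ring
    have e3 : 1 / (2 * (2 / M)) = M / 4 := by field_simp; norm_num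
    rw [e1, e2, e3]
    have h1 := half_zeroCost_le (κ := (M + 4) / M) (x := X / M) (by positivity)
      (by gcongr; linarith)
    have h2 : X / M / ((M + 4) / M * ((M + 4) / M - X / M)) ≤ 0.195 := by
      have : X / M / ((M + 4) / M * ((M + 4) / M - X / M)) = X * M / ((M + 4) * (M + 4 - X)) := by
        have : M + 4 - X ≠ 0 := by linarith
        rw [← sub_div]
        field_simp
      rw [this, div_le_iff₀ (mul_pos (by linarith) (by linarith))]
      nlinarith [sq_nonneg (M - 2.607), mul_nonneg hM0.le (sub_nonneg.2 hX2)]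
    have h3 := div_sq_add_sq_ge (x := X / M) (c := 0.405 * M) (g := 0.8 / M) (y := y)
      (by positivity) (by rw [le_div_iff₀ hM0]; exact hy) (by
        have : 0.405 * M * ((X / M) ^ 2 + (0.8 / M) ^ 2) = 0.405 * (X ^ 2 + 0.64) / M := by
          field_simp; ring
        rw [this]
        gcongr
        nlinarith) (by positivity)
    linarith

/-- A non-principal character has at most one zero close to the point `1`. -/
lemma false_of_two_zeros {q : ℕ} [NeZero q] (hq : 3 ≤ q) {χ : DirichletCharacter ℂ q} (h1 : χ ≠ 1)
    {ρ₁ ρ₂ : ℂ} {l₁ l₂ : ℝ} (hl₁ : 0 < l₁) (hl₂ : 0 < l₂) (hρ₁ : ρ₁.re = 1 - l₁)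
    (hρ₂ : ρ₂.re = 1 - l₂) (hL₁ : 6.397 * l₁ * Real.log q ≤ 1)
    (hL₂ : 6.397 * l₂ * Real.log q ≤ 1) (h₁ : LFunction χ ρ₁ = 0) (h₂ : LFunction χ ρ₂ = 0)
    (ht₁ : |ρ₁.im| * Real.log q ≤ 0.8) (ht₂ : |ρ₂.im| * Real.log q ≤ 0.8) (hne : ρ₁ ≠ ρ₂) :
    False := by
  classical
  have hM : 1.0986 ≤ Real.log q := by
    have h1 : Real.log 3 ≤ Real.log q := Real.log_le_log (by norm_num) (by exact_mod_cast hq)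
    have h3 := Real.log_three_gt_d9
    linarith
  have c₁ := zero_contribution_lt hM hl₁ hL₁ ht₁
  have c₂ := zero_contribution_lt hM hl₂ hL₂ ht₂
  have hlc := log_conductor_le χ
  have hl₁' : l₁ ≤ 0.1428 := by nlinarith
  have hl₂' : l₂ ≤ 0.1428 := by nlinarith
  set δ := min (3 / 2) (2 / Real.log q) with hδdef
  have hδ : 0 < δ := lt_min (by norm_num) (div_pos (by norm_num) (by linarith))
  have hδ' : δ ≤ 3 / 2 := min_le_left _ _
  have hB : 5 / 2 + (1 + 2 * δ) ^ 2 / 3 ≤ 7.84 := by nlinarith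
  have hpos := sum_inducedSum_nonneg (n := 2) ![1, χ] hδ (fun u ↦ by
    have h2 : ‖χ u‖ = 1 := norm_apply_unit χ u
    have h3 := abs_le.1 (abs_re_le_norm (χ u))
    rw [h2] at h3
    simp only [Fin.sum_univ_two, Matrix.cons_val, MulChar.one_apply_coe, one_re]
    linarith)
  simp only [Fin.sum_univ_two, Matrix.cons_val] at hpos
  have b1 := inducedSum_zero_le (1 : DirichletCharacter ℂ q) hδ hδ' hB exp_const_low ∅ (by simp)
  have b2 := inducedSum_zero_le χ hδ hδ' hB exp_const_low {ρ₁, ρ₂} (by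
    intro r hr
    rw [Finset.mem_insert, Finset.mem_singleton] at hr
    rcases hr with rfl | rfl
    · exact ⟨by linarith, by linarith, h₁⟩
    · exact ⟨by linarith, by linarith, h₂⟩)
  rw [log_conductor_one, if_pos rfl, Finset.sum_empty] at b1
  rw [if_neg h1, Finset.sum_pair hne, hρ₁, hρ₂] at b2
  have e : 1 / (2 * δ) = 1 / 2 * (1 / δ) := by field_simp
  rw [e] at c₁ c₂
  linarith

/-- At most one quadratic character has a real zero close to `1`. -/
lemma false_of_zeros_of_ne {q : ℕ} [NeZero q] (hq : 3 ≤ q) {χ₁ χ₂ : DirichletCharacter ℂ q}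
    (h1 : χ₁ ≠ 1) (h2 : χ₂ ≠ 1) (hs1 : χ₁ ^ 2 = 1) (hs2 : χ₂ ^ 2 = 1) (hne : χ₁ ≠ χ₂)
    {ρ₁ ρ₂ : ℂ} {l₁ l₂ : ℝ} (hl₁ : 0 < l₁) (hl₂ : 0 < l₂) (hρ₁ : ρ₁.re = 1 - l₁)
    (hρ₂ : ρ₂.re = 1 - l₂) (hL₁ : 6.397 * l₁ * Real.log q ≤ 1)
    (hL₂ : 6.397 * l₂ * Real.log q ≤ 1) (h₁ : LFunction χ₁ ρ₁ = 0) (h₂ : LFunction χ₂ ρ₂ = 0)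
    (ht₁ : ρ₁.im = 0) (ht₂ : ρ₂.im = 0) : False := by
  have hM : 1.0986 ≤ Real.log q := by
    have h1 : Real.log 3 ≤ Real.log q := Real.log_le_log (by norm_num) (by exact_mod_cast hq)
    have h3 := Real.log_three_gt_d9
    linarith
  have c1 := log_conductor_le χ₁
  have c2 := log_conductor_le χ₂
  have c3 := log_conductor_le (χ₁ * χ₂)
  have h3 : χ₁ * χ₂ ≠ 1 := fun h ↦ hne (by
    calc χ₁ = χ₁ * (χ₂ ^ 2) := by rw [hs2, mul_one]
      _ = χ₁ * χ₂ * χ₂ := by rw [pow_two, mul_assoc]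
      _ = χ₂ := by rw [h, one_mul])
  have hpm : ∀ (χ : DirichletCharacter ℂ q), χ ^ 2 = 1 → ∀ u : (ZMod q)ˣ, χ u = 1 ∨ χ u = -1 := by
    intro χ hχ u
    have : χ u ^ 2 = 1 := by
      rw [← MulChar.pow_apply_coe, hχ, MulChar.one_apply_coe]
    exact sq_eq_one_iff.1 this
  generalize Real.log q = M at *
  have hM0 : 0 < M := by linarith
  set δ := 0.39 / M with hδdef
  have hδ : 0 < δ := by positivity
  have hδ1 : δ ≤ 0.3551 := by rw [hδdef, div_le_iff₀ hM0]; linarith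
  have hB : 5 / 2 + (1 + 2 * δ) ^ 2 / 3 ≤ 3.5 := by nlinarith
  have key : ∀ l, 0 < l → 6.397 * l * M ≤ 1 →
      1 / 2 * zeroCost (1 + 2 * δ) (1 + δ - (1 - l)) -
        (1 + δ - (1 - l)) / ((1 + δ - (1 - l)) ^ 2 + 0 ^ 2) ≤ 0.498 - 1.83 * M := by
    intro l hl hL
    have hlδ : l ≤ δ := by rw [hδdef, le_div_iff₀ hM0]; linarith
    have hx : δ + l ≤ 0.5464 / M := by
      have : l ≤ 0.1564 / M := by rw [le_div_iff₀ hM0]; linarith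
      calc δ + l ≤ 0.39 / M + 0.1564 / M := by linarith
        _ = _ := by ring
    have hx' : 0.5464 / M ≤ 0.498 := by rw [div_le_iff₀ hM0]; linarith
    rw [show 1 + δ - (1 - l) = δ + l by ring]
    have h1 := half_zeroCost_le (κ := 1 + 2 * δ) (x := δ + l) (by linarith) (by linarith)
    have h2 : (δ + l) / ((1 + 2 * δ) * (1 + 2 * δ - (δ + l))) ≤ δ + l := by
      refine div_le_self (by linarith) ?_
      nlinarith
    have h3 : 1.83 * M ≤ (δ + l) / ((δ + l) ^ 2 + 0 ^ 2) := by
      have : (δ + l) / ((δ + l) ^ 2 + 0 ^ 2) = 1 / (δ + l) := by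
        have : δ + l ≠ 0 := by linarith
        field_simp; ring
      rw [this, le_div_iff₀ (by linarith)]
      rw [le_div_iff₀ hM0] at hx
      linarith
    linarith
  have k1 := key l₁ hl₁ hL₁
  have k2 := key l₂ hl₂ hL₂
  have hl₁' : l₁ ≤ 0.1428 := by nlinarith
  have hl₂' : l₂ ≤ 0.1428 := by nlinarith
  have hpos := sum_inducedSum_nonneg (n := 4) ![1, χ₁, χ₂, χ₁ * χ₂] hδ (fun u ↦ by
    simp only [Fin.sum_univ_four, Matrix.cons_val, MulChar.one_apply_coe, MulChar.mul_apply]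
    rcases hpm χ₁ hs1 u with h | h <;> rcases hpm χ₂ hs2 u with h' | h' <;> rw [h, h'] <;> norm_num)
  simp only [Fin.sum_univ_four, Matrix.cons_val] at hpos
  have b0 := inducedSum_zero_le (1 : DirichletCharacter ℂ q) hδ (by linarith) hB exp_const_real ∅
    (by simp)
  have b1 := inducedSum_zero_le χ₁ hδ (by linarith) hB exp_const_real {ρ₁} (by
    simp only [Finset.mem_singleton, forall_eq]; exact ⟨by linarith, by linarith, h₁⟩)
  have b2 := inducedSum_zero_le χ₂ hδ (by linarith) hB exp_const_real {ρ₂} (by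
    simp only [Finset.mem_singleton, forall_eq]; exact ⟨by linarith, by linarith, h₂⟩)
  have b3 := inducedSum_zero_le (χ₁ * χ₂) hδ (by linarith) hB exp_const_real ∅ (by simp)
  rw [log_conductor_one, if_pos rfl, Finset.sum_empty] at b0
  rw [if_neg h1, Finset.sum_singleton, hρ₁, ht₁] at b1
  rw [if_neg h2, Finset.sum_singleton, hρ₂, ht₂] at b2
  rw [if_neg h3, Finset.sum_empty] at b3
  have e : 1 / δ ≤ 2.5642 * M := by
    rw [hδdef, one_div_div, div_le_iff₀ (by norm_num)]; linarith
  linarith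

/-- The Euler factors `∏ (1 - p ^ (-s))` over the prime divisors of `q`, at a real point. -/
noncomputable def eulerFactor (q : ℕ) (x : ℝ) : ℝ := ∏ p ∈ q.primeFactors, (1 - (p : ℝ) ^ (-x))

lemma eulerFactor_pos (q : ℕ) {x : ℝ} (hx : 0 < x) : 0 < eulerFactor q x := by
  refine Finset.prod_pos fun p hp ↦ ?_
  have h : (1 : ℝ) < p := by exact_mod_cast (Nat.prime_of_mem_primeFactors hp).one_lt
  have := Real.rpow_lt_one_of_one_lt_of_neg h (neg_lt_zero.2 hx)
  linarith

lemma eulerFactor_mono (q : ℕ) {x y : ℝ} (hx : 0 < x) (hxy : x ≤ y) :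
    eulerFactor q x ≤ eulerFactor q y := by
  refine Finset.prod_le_prod (fun p hp ↦ ?_) fun p hp ↦ ?_
  all_goals have h : (1 : ℝ) < p := by exact_mod_cast (Nat.prime_of_mem_primeFactors hp).one_lt
  · have := Real.rpow_lt_one_of_one_lt_of_neg h (neg_lt_zero.2 hx)
    linarith
  · have := Real.rpow_le_rpow_of_exponent_le h.le (neg_le_neg hxy)
    linarith

lemma eulerFactor_one (q : ℕ) [NeZero q] : (q.totient : ℝ) = q * eulerFactor q 1 := by
  have h := congrArg (Rat.cast : ℚ → ℝ) (Nat.totient_eq_mul_prod_factors q)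
  push_cast at h
  simpa [eulerFactor, Real.rpow_neg_one] using h

lemma continuous_eulerFactor (q : ℕ) : Continuous (eulerFactor q) := by
  refine continuous_finsetProd _ fun p hp ↦ ?_
  have h : (p : ℝ) ≠ 0 := by exact_mod_cast (Nat.prime_of_mem_primeFactors hp).ne_zero
  exact continuous_const.sub (Real.continuous_const_rpow h |>.comp continuous_neg)

lemma exists_real_Gammaℝ : ∃ G : ℝ → ℝ, (∀ x : ℝ, Gammaℝ x = G x) ∧ (∀ x, 0 < x → 0 < G x) ∧
    G 1 = 1 ∧ ContinuousAt G 1 := by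
  have h : ∀ x : ℝ, Gammaℝ x = (π ^ (-x / 2) * Real.Gamma (x / 2) : ℝ) := fun x ↦ by
    rw [Gammaℝ_def, Complex.ofReal_mul, Complex.ofReal_cpow Real.pi_pos.le, ← Complex.Gamma_ofReal]
    push_cast; rfl
  refine ⟨fun x ↦ π ^ (-x / 2) * Real.Gamma (x / 2), h, fun x hx ↦ ?_, ?_, ?_⟩
  · exact mul_pos (Real.rpow_pos_of_pos Real.pi_pos _) (Real.Gamma_pos_of_pos (by positivity))
  · have := h 1
    rw [Complex.ofReal_one, Gammaℝ_one] at this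
    exact (Complex.ofReal_injective this).symm
  · refine ContinuousAt.mul ?_ ?_
    · exact ((Real.continuous_const_rpow Real.pi_pos.ne').comp
        (continuous_neg.div_const 2)).continuousAt
    · refine ContinuousAt.comp (f := fun x : ℝ ↦ x / 2) (g := Real.Gamma) ?_
        (continuous_id.div_const 2).continuousAt
      refine (Real.differentiableAt_Gamma fun m ↦ ?_).continuousAt
      have : (0 : ℝ) ≤ m := Nat.cast_nonneg m
      intro h
      linarith

/-- With the library value of `hurwitzZeta` at its pole, the principal `L`-function does not vanish
at `1`. -/
lemma LFunction_one_apply_one_ne_zero {q : ℕ} [NeZero q] (hq : 3 ≤ q) :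
    LFunction (1 : DirichletCharacter ℂ q) 1 ≠ 0 := by
  set g : ℂ → ℂ := fun s ↦ 1 / (s - 1) / Gammaℝ s with hg
  have hg1 : g 1 = 0 := by simp [hg]
  set R : ℂ → ℂ := fun s ↦ riemannZeta s - g s with hR
  have hRc : ContinuousAt R 1 := by
    have := (HurwitzZeta.differentiableAt_hurwitzZeta_sub_one_div 0).continuousAt
    simpa only [HurwitzZeta.hurwitzZeta_zero] using this
  set F : ℂ → ℂ := fun s ↦ LFunction (1 : DirichletCharacter ℂ q) s -
    (q : ℂ) ^ (-s) * (q.totient * g s) with hF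
  have hsum : ∑ j : ZMod q, (1 : DirichletCharacter ℂ q) j = q.totient := by
    rw [MulChar.sum_one_eq_card_units, ZMod.card_units_eq_totient]
  have hq0 : (q : ℂ) ≠ 0 := Nat.cast_ne_zero.2 (NeZero.ne q)
  have hFc : ContinuousAt F 1 := by
    have h := (DifferentiableAt.fun_sum (u := Finset.univ) fun (j : ZMod q) _ ↦
      (HurwitzZeta.differentiableAt_hurwitzZeta_sub_one_div (ZMod.toAddCircle j)).const_mul
        ((1 : DirichletCharacter ℂ q) j)).continuousAt
    have h2 : ContinuousAt (fun s : ℂ ↦ (q : ℂ) ^ (-s)) 1 :=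
      (continuousAt_const_cpow hq0).comp continuousAt_neg
    refine (h2.mul h).congr (Eventually.of_forall fun s ↦ ?_)
    simp only [hF, LFunction, ZMod.LFunction, Pi.mul_apply, mul_sub, Finset.sum_sub_distrib,
      ← Finset.sum_mul, hsum, hg]
  have hF1 : F 1 = LFunction (1 : DirichletCharacter ℂ q) 1 := by simp [hF, hg1]
  have hR1 : (R 1).re = (Real.eulerMascheroniConstant - Real.log (4 * π)) / 2 := by
    have : R 1 = ((Real.eulerMascheroniConstant - Real.log (4 * π)) / 2 : ℝ) := by
      simp only [hR, hg1, sub_zero, riemannZeta_one]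
      rw [show (4 * (π : ℂ)) = ((4 * π : ℝ) : ℂ) by push_cast; rfl,
        ← Complex.ofReal_log (by positivity)]
      push_cast; rfl
    rw [this, Complex.ofReal_re]
  set L := Real.log q with hL
  have hL1 : Real.log 3 ≤ L := Real.log_le_log (by norm_num) (by exact_mod_cast hq)
  have hL0 : 0 < L := lt_of_lt_of_le (Real.log_pos (by norm_num)) hL1
  obtain ⟨G, hG, hG0, hG1, hGc⟩ := exists_real_Gammaℝ
  have key : ∀ x : ℝ, 1 < x →
      eulerFactor q x * (R x).re + eulerFactor q 1 * (L / (1 + (x - 1) * L) / G x) ≤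
        (F x).re := by
    intro x hx
    have hx0 : 0 < x - 1 := sub_pos.2 hx
    have hGx := hG0 x (by linarith)
    have hxc : (x : ℂ) ≠ 1 := by exact_mod_cast hx.ne'
    have hgx : g x = (1 / (x - 1) / G x : ℝ) := by
      simp only [hg, hG]; push_cast; rfl
    have hq : (q : ℂ) ^ (-(x : ℂ)) = ((q : ℝ) ^ (-x) : ℝ) := by
      rw [Complex.ofReal_cpow (Nat.cast_nonneg q)]; push_cast; rfl
    have hLx : LFunction (1 : DirichletCharacter ℂ q) x = eulerFactor q x * (R x + g x) := by
      have := LFunctionTrivChar_eq_mul_riemannZeta (N := q) hxc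
      rw [LFunctionTrivChar] at this
      rw [this, hR, sub_add_cancel, eulerFactor, Complex.ofReal_prod]
      congr 1
      refine Finset.prod_congr rfl fun p _ ↦ ?_
      rw [Complex.ofReal_sub, Complex.ofReal_cpow (Nat.cast_nonneg p)]; push_cast; rfl
    have hre : (F x).re = eulerFactor q x * (R x).re +
        (eulerFactor q x - (q : ℝ) ^ (-x) * q.totient) * (1 / (x - 1) / G x) := by
      have : F x = (eulerFactor q x : ℝ) * R x +
          (((eulerFactor q x - (q : ℝ) ^ (-x) * q.totient) * (1 / (x - 1) / G x) : ℝ) : ℂ) := by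
        simp only [hF]
        rw [hLx, hgx, hq]; push_cast; ring
      rw [this, Complex.add_re, Complex.re_ofReal_mul, Complex.ofReal_re]
    rw [hre, eulerFactor_one]
    have hqp : (0 : ℝ) < q := Nat.cast_pos.2 (NeZero.pos q)
    have h1 : (q : ℝ) ^ (-x) * q = Real.exp (-((x - 1) * L)) := by
      rw [Real.rpow_def_of_pos hqp]
      nth_rewrite 2 [← Real.exp_log hqp]
      rw [← Real.exp_add]; congr 1; simp only [hL]; ring
    have h2 : Real.exp (-((x - 1) * L)) ≤ 1 / (1 + (x - 1) * L) := by
      rw [Real.exp_neg, ← one_div]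
      refine one_div_le_one_div_of_le (by positivity) ?_
      linarith [Real.add_one_le_exp ((x - 1) * L)]
    have hE1 := eulerFactor_pos q one_pos
    have h3 := eulerFactor_mono q one_pos hx.le
    have h4 : eulerFactor q 1 * (1 - 1 / (1 + (x - 1) * L)) ≤
        eulerFactor q x - (q : ℝ) ^ (-x) * (q * eulerFactor q 1) := by
      rw [← mul_assoc, h1]
      have := mul_le_mul_of_nonneg_left h2 hE1.le
      linarith
    have h5 := mul_le_mul_of_nonneg_right h4 (show 0 ≤ 1 / (x - 1) / G x by positivity)
    have h6 : eulerFactor q 1 * (1 - 1 / (1 + (x - 1) * L)) * (1 / (x - 1) / G x) =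
        eulerFactor q 1 * (L / (1 + (x - 1) * L) / G x) := by
      have : 1 + (x - 1) * L ≠ 0 := by positivity
      field_simp
      ring
    linarith
  have hr : ∀ H : ℂ → ℂ, ContinuousAt H 1 → ContinuousAt (fun x : ℝ ↦ (H x).re) 1 := by
    intro H hH
    rw [← Complex.ofReal_one] at hH
    exact Complex.continuous_re.continuousAt.comp
      (ContinuousAt.comp (f := fun x : ℝ ↦ (x : ℂ)) hH Complex.continuous_ofReal.continuousAt)
  have hRr := hr R hRc
  have hFr := hr F hFc
  have ht1 : Tendsto (fun x : ℝ ↦ eulerFactor q x * (R x).re +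
      eulerFactor q 1 * (L / (1 + (x - 1) * L) / G x)) (𝓝[>] 1)
      (𝓝 (eulerFactor q 1 * (R 1).re + eulerFactor q 1 * L)) := by
    have h1 : ContinuousAt (fun x : ℝ ↦ L / (1 + (x - 1) * L) / G x) 1 := by
      refine ContinuousAt.div (ContinuousAt.div continuousAt_const ?_ (by simp)) hGc (by simp [hG1])
      fun_prop
    have h2 := (((continuous_eulerFactor q).continuousAt.mul hRr).add
      (h1.const_mul (eulerFactor q 1))).tendsto.mono_left (nhdsWithin_le_nhds (s := Ioi 1))
    simp only [Pi.add_apply, Pi.mul_apply, Complex.ofReal_one, sub_self, zero_mul, add_zero,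
      div_one, hG1] at h2
    exact h2
  have ht2 : Tendsto (fun x : ℝ ↦ (F x).re) (𝓝[>] 1) (𝓝 (F 1).re) := by
    simpa using hFr.tendsto.mono_left (nhdsWithin_le_nhds (s := Ioi 1))
  have hle := le_of_tendsto_of_tendsto ht1 ht2
    (eventually_nhdsWithin_of_forall fun x hx ↦ key x hx)
  intro h0
  rw [hF1, h0, Complex.zero_re, hR1] at hle
  have hE := eulerFactor_pos q one_pos
  have hγ := Real.one_half_lt_eulerMascheroniConstant
  have hpi : Real.log (4 * π) ≤ 2 * Real.log 3 + 1 / 2 := by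
    have he : (3 / 2 : ℝ) ≤ Real.exp (1 / 2) := by linarith [Real.add_one_le_exp (1 / 2 : ℝ)]
    have hpi := Real.pi_lt_d2
    calc Real.log (4 * π) ≤ Real.log (3 ^ 2 * Real.exp (1 / 2)) :=
          Real.log_le_log (by positivity) (by linarith)
      _ = 2 * Real.log 3 + 1 / 2 := by
          rw [Real.log_mul (by norm_num) (Real.exp_ne_zero _), Real.log_pow, Real.log_exp]
          norm_num
  nlinarith

lemma exists_real_quadratic_zero {q : ℕ} [NeZero q] (hq : 3 ≤ q) {s : ℂ}
    (h0 : (∏ χ : DirichletCharacter ℂ q, LFunction χ s) = 0)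
    (hs : s.re ≥ 1 - 1 / (6.3970 * Real.log (q * max 1 |s.im|))) :
    s.im = 0 ∧ ∃ (χ : DirichletCharacter ℂ q) (l : ℝ), χ ≠ 1 ∧ χ ^ 2 = 1 ∧ LFunction χ s = 0 ∧
      0 < l ∧ s.re = 1 - l ∧ 6.397 * l * Real.log q ≤ 1 := by
  obtain ⟨χ, -, hχ⟩ := Finset.prod_eq_zero_iff.1 h0
  have hs1 : s ≠ 1 := by
    rintro rfl
    by_cases h1 : χ = 1
    · exact LFunction_one_apply_one_ne_zero hq (h1 ▸ hχ)
    · exact LFunction_apply_one_ne_zero h1 hχ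
  have hl : 0 < 1 - s.re := by
    by_contra! h
    exact LFunction_ne_zero_of_one_le_re χ (.inr hs1) (by linarith) hχ
  have hq1 : (1 : ℝ) < q := by exact_mod_cast (by omega : 1 < q)
  have hLq : 0 < Real.log q := Real.log_pos hq1
  have hLT : 0 ≤ Real.log (max 1 |s.im|) := Real.log_nonneg (le_max_left _ _)
  obtain ⟨l, hldef⟩ : ∃ l, l = 1 - s.re := ⟨_, rfl⟩
  rw [← hldef] at hl
  have hρ : s.re = 1 - l := by linarith
  have hL : 6.397 * l * (Real.log q + Real.log (max 1 |s.im|)) ≤ 1 := by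
    have hle : l ≤ 1 / (6.3970 * Real.log (q * max 1 |s.im|)) := by linarith
    rw [Real.log_mul (by positivity) (by positivity), le_div_iff₀ (by positivity)] at hle
    linarith
  have hLl : 6.397 * l * Real.log q ≤ 1 := by nlinarith [mul_nonneg hl.le hLT]
  have h2 : χ ^ 2 = 1 := by
    by_contra h
    exact false_of_zero_of_sq_ne_one hq hl hρ hL hχ h
  have h1 : χ ≠ 1 := by
    rintro rfl
    rcases le_total |s.im| (4 / 3) with ht | ht
    · exact false_of_zero_of_principal_low hl (distance_le hq hl hL) hρ hχ ht
    · exact false_of_zero_of_principal_high hq hl hρ hL hχ ht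
  refine ⟨?_, χ, l, h1, h2, hχ, hl, hρ, hLl⟩
  rcases le_total 0.8 (|s.im| * Real.log q) with ht | ht
  · exact (false_of_zero_of_quadratic_high hq hl hρ hL hχ h1 h2 ht).elim
  by_contra him
  have hinv : χ⁻¹ = χ := inv_eq_of_mul_eq_one_left (by rw [← pow_two, h2])
  have hc := LFunction_inv_conj_eq_zero (by linarith) hχ
  rw [hinv] at hc
  refine false_of_two_zeros hq h1 hl hl hρ (by simpa using hρ) hLl hLl hχ hc ht
    (by simpa using ht) fun h ↦ him ?_
  have := congrArg Complex.im h
  rw [Complex.conj_im] at this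
  linarith

end KadiriZeroFree

/-- **Theorem 1 (Kadiri).** For `q ≥ 3`, the product `ℒ_q(s) = ∏_χ L(s,χ)` of the
Dirichlet `L`-functions over all Dirichlet characters modulo `q` has at most one zero
in the region `Re s ≥ 1 - 1/(6.3970 * log (q * max 1 |Im s|))`, and such a zero,
if it exists, is real. -/
theorem product_of_L_functions_zero_free_region (q : ℕ) (hq : 3 ≤ q) :
    letI : NeZero q := ⟨by omega⟩
    (∀ s₁ s₂ : ℂ,
        (∏ χ : DirichletCharacter ℂ q, DirichletCharacter.LFunction χ s₁) = 0 →
        (∏ χ : DirichletCharacter ℂ q, DirichletCharacter.LFunction χ s₂) = 0 →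
        s₁.re ≥ 1 - 1 / (6.3970 * Real.log (q * max 1 |s₁.im|)) →
        s₂.re ≥ 1 - 1 / (6.3970 * Real.log (q * max 1 |s₂.im|)) →
        s₁ = s₂) ∧
      ∀ s : ℂ,
        (∏ χ : DirichletCharacter ℂ q, DirichletCharacter.LFunction χ s) = 0 →
        s.re ≥ 1 - 1 / (6.3970 * Real.log (q * max 1 |s.im|)) →
        s.im = 0 := by
  let : NeZero q := ⟨by omega⟩
  refine ⟨fun s₁ s₂ h₁ h₂ hs₁ hs₂ ↦ ?_,
    fun s h hs ↦ (KadiriZeroFree.exists_real_quadratic_zero hq h hs).1⟩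
  obtain ⟨hi₁, χ₁, l₁, hn₁, hsq₁, hz₁, hl₁, hρ₁, hL₁⟩ :=
    KadiriZeroFree.exists_real_quadratic_zero hq h₁ hs₁
  obtain ⟨hi₂, χ₂, l₂, hn₂, hsq₂, hz₂, hl₂, hρ₂, hL₂⟩ :=
    KadiriZeroFree.exists_real_quadratic_zero hq h₂ hs₂
  by_contra hne
  by_cases hχ : χ₁ = χ₂
  · subst hχ
    exact KadiriZeroFree.false_of_two_zeros hq hn₁ hl₁ hl₂ hρ₁ hρ₂ hL₁ hL₂ hz₁ hz₂
      (by rw [hi₁]; norm_num) (by rw [hi₂]; norm_num) hne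
  · exact KadiriZeroFree.false_of_zeros_of_ne hq hn₁ hn₂ hsq₁ hsq₂ hχ hl₁ hl₂ hρ₁ hρ₂ hL₁ hL₂
      hz₁ hz₂ hi₁ hi₂
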